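/- arXiv:math/0701509 — 2 statements merged into one kernel-verified Lean document; each statement's English description precedes it below -/
import Mathlib

section
/- Let R be a standard graded Noetherian algebra over a regular local ring (R₀, m₀, k) of dimension d, and suppose m₀ contains an R-regular sequence of length d. Then reg_R(k,k) = d, where reg_R(k,k) = sup_i { end(Ext^i_R(k,k)) + i }. -/
open DirectSum CategoryTheory CategoryTheory.Limits Opposite

noncomputable section
section GradedSetup

variable (R₀ : Type) [CommRing R₀] (R : Type) [CommRing R] [Algebra R₀ R]
variable (𝒜 : ℤ → Submodule R₀ R)

/-- `R = R₀[R₁]` is a standard graded ring: nonnegatively graded, `𝒜 0 = R₀·1` and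
generated in degree one. -/
def IsStandardGraded : Prop :=
  (∀ n : ℤ, n < 0 → 𝒜 n = ⊥) ∧ (𝒜 0 = 1) ∧ (∀ n : ℤ, 0 ≤ n → 𝒜 (n + 1) = 𝒜 n * 𝒜 1)

/-- The irrelevant ideal `R₊` of a graded ring. -/
def irrelevant : Ideal R :=
  Ideal.span (⋃ n : {n : ℤ // 0 < n}, ((𝒜 n.1 : Submodule R₀ R) : Set R))

/-- The graded maximal ideal `m₀ R + R₊` when `R₀` is local. -/
def gradedMax [IsLocalRing R₀] : Ideal R :=
  irrelevant R₀ R 𝒜 ⊔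
    Ideal.span ((algebraMap R₀ R) '' (IsLocalRing.maximalIdeal R₀ : Set R₀))

end GradedSetup

section Degrees

variable {A M : Type} [Semiring A] [AddCommMonoid M] [Module A M]

/-- The set of degrees in which a graded module is nonzero. -/
def degSet (ℳ : ℤ → Submodule A M) : Set ℤ := {n | ℳ n ≠ ⊥}

/-- The initial degree of a graded module. -/
noncomputable def indeg (ℳ : ℤ → Submodule A M) : ℤ := sInf (degSet ℳ)

/-- The end (top degree) of a graded module. -/
noncomputable def endeg (ℳ : ℤ → Submodule A M) : ℤ := sSup (degSet ℳ)

end Degrees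
section FreeRes

variable (R₀ : Type) [CommRing R₀] (R : Type) [CommRing R] [Algebra R₀ R]
variable (𝒜 : ℤ → Submodule R₀ R)

/-- The graded free module `⊕_j R(-j)^{β j}`. -/
abbrev stdFree (β : ℤ → ℕ) : Type := (Σ j : ℤ, Fin (β j)) →₀ R

/-- The degree `n` component of `⊕_j R(-j)^{β j}`. -/
def stdFreeGrading (β : ℤ → ℕ) (n : ℤ) : Submodule R₀ (stdFree R β) where
  carrier := {f | ∀ p : Σ j : ℤ, Fin (β j), f p ∈ 𝒜 (n - p.1)}
  add_mem' := fun hf hg p => by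
    rw [Finsupp.add_apply]; exact add_mem (hf p) (hg p)
  zero_mem' := fun p => by simp
  smul_mem' := fun c f hf p => by
    rw [Finsupp.smul_apply]; exact Submodule.smul_mem _ c (hf p)

variable (M : Type) [AddCommGroup M] [Module R M] [Module R₀ M]

/-- A graded free resolution of a graded `R`-module `(M, ℳ)`, recorded through its
graded Betti numbers `β`, differentials `d` and augmentation `aug`. -/
structure GradedFreeRes (ℳ : ℤ → Submodule R₀ M) where
  β : ℕ → ℤ → ℕ
  finite : ∀ i, (Function.support (β i)).Finite
  d : (i : ℕ) → stdFree R (β (i + 1)) →ₗ[R] stdFree R (β i)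
  aug : stdFree R (β 0) →ₗ[R] M
  aug_surj : Function.Surjective aug
  exact_aug : Function.Exact (d 0) aug
  exact : ∀ i, Function.Exact (d (i + 1)) (d i)
  graded_d : ∀ i n x, x ∈ stdFreeGrading R₀ R 𝒜 (β (i + 1)) n →
    d i x ∈ stdFreeGrading R₀ R 𝒜 (β i) n
  graded_aug : ∀ n x, x ∈ stdFreeGrading R₀ R 𝒜 (β 0) n → aug x ∈ ℳ n

/-- A minimal graded free resolution: a graded free resolution whose differentials map into
`m·F` where `m` is the given (graded) maximal ideal. -/
structure MinGradedFreeRes (mIdeal : Ideal R) (ℳ : ℤ → Submodule R₀ M)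
    extends GradedFreeRes R₀ R 𝒜 M ℳ where
  minimal : ∀ i, LinearMap.range (d i) ≤ mIdeal • (⊤ : Submodule R (stdFree R (β i)))

/-- The initial degree of the `i`-th Tor module `Tor_i(M,k)` read off from a minimal graded
free resolution: the smallest twist appearing in homological degree `i`. -/
def torDegSet {mIdeal : Ideal R} {ℳ : ℤ → Submodule R₀ M}
    (F : MinGradedFreeRes R₀ R 𝒜 M mIdeal ℳ) (i : ℕ) : Set ℤ :=
  {j | F.β i j ≠ 0}

/-- The set `{i - j | β_{ij} ≠ 0}` whose supremum is `reg_R(M,k) = max_i {i - indeg Tor_i(M,k)}`. -/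
def regSet {mIdeal : Ideal R} {ℳ : ℤ → Submodule R₀ M}
    (F : MinGradedFreeRes R₀ R 𝒜 M mIdeal ℳ) : Set ℤ :=
  {z | ∃ (i : ℕ) (j : ℤ), F.β i j ≠ 0 ∧ z = (i : ℤ) - j}

end FreeRes
section Residue

variable (R₀ : Type) [CommRing R₀] [IsLocalRing R₀] (R : Type) [CommRing R] [Algebra R₀ R]
variable (𝒜 : ℤ → Submodule R₀ R)

/-- The residue field `k = R/(m₀ R + R₊)` of a standard graded ring over a local base. -/
abbrev resField : Type := R ⧸ gradedMax R₀ R 𝒜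

/-- The grading of the residue field: concentrated in degree `0`. -/
def resFieldGrading (n : ℤ) : Submodule R₀ (resField R₀ R 𝒜) :=
  if n = 0 then ⊤ else ⊥

end Residue

/-- `R₀` is a regular local ring of dimension `d`: Noetherian local, of Krull dimension `d`,
whose maximal ideal is generated by `d` elements. -/
def IsRegularLocal (R₀ : Type) [CommRing R₀] [IsLocalRing R₀] (d : ℕ) : Prop :=
  IsNoetherianRing R₀ ∧ ringKrullDim R₀ = d ∧
    ∃ s : Finset R₀, s.card = d ∧ Ideal.span (s : Set R₀) = IsLocalRing.maximalIdeal R₀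

/-- Prime avoidance for a coset `x + I`. -/
theorem Ideal.exists_add_notMem_of_finset_prime {A : Type*} [CommRing A] (T : Finset (Ideal A))
    (hT : ∀ P ∈ T, P.IsPrime) (x : A) (I : Ideal A)
    (h : ∀ P ∈ T, x ∈ P → ¬ I ≤ P) : ∃ y ∈ I, ∀ P ∈ T, x + y ∉ P := by
  classical
  induction T using Finset.strongInduction with
  | H T ih =>
    rcases T.eq_empty_or_nonempty with rfl | hne
    · exact ⟨0, I.zero_mem, by simp⟩
    obtain ⟨P, hPmin⟩ := T.exists_minimal hne
    have hP := hPmin.prop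
    obtain ⟨y, hyI, hy⟩ := ih (T.erase P) (Finset.erase_ssubset hP)
      (fun Q hQ => hT Q (Finset.mem_of_mem_erase hQ))
      (fun Q hQ => h Q (Finset.mem_of_mem_erase hQ))
    by_cases hxy : x + y ∈ P
    · have hIP : ¬ I ≤ P := fun hle =>
        h P hP ((P.add_mem_iff_left (hle hyI)).1 hxy) hle
      have hPp := hT P hP
      have hnot : ¬ I ⊓ (T.erase P).inf id ≤ P := by
        rw [hPp.inf_le, not_or]
        refine ⟨hIP, ?_⟩
        rw [hPp.inf_le']
        rintro ⟨Q, hQ, hQP⟩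
        exact Finset.ne_of_mem_erase hQ
          (le_antisymm hQP (hPmin.le_of_le (Finset.mem_of_mem_erase hQ) hQP))
      obtain ⟨z, ⟨hzI, hzQ⟩, hzP⟩ := SetLike.not_le_iff_exists.1 hnot
      refine ⟨y + z, I.add_mem hyI hzI, fun Q hQ hmem => ?_⟩
      rw [← add_assoc] at hmem
      by_cases hQP : Q = P
      · subst hQP
        exact hzP ((Q.add_mem_iff_right hxy).1 hmem)
      · have hQ' := Finset.mem_erase.2 ⟨hQP, hQ⟩
        have hzQ' : z ∈ Q := (Finset.inf_le (f := id) hQ') hzQ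
        exact hy Q hQ' ((Q.add_mem_iff_left hzQ').1 hmem)
    · refine ⟨y, hyI, fun Q hQ => ?_⟩
      by_cases hQP : Q = P
      · exact hQP ▸ hxy
      · exact hy Q (Finset.mem_erase.2 ⟨hQP, hQ⟩)

section Exchange

open IsLocalRing RingTheory.Sequence Module

/-- If an ideal generated by `n` elements of a Noetherian local ring contains, up to the
annihilator of `M`, a weakly `M`-regular sequence of length `n`, then the generators themselves
form a weakly `M`-regular sequence. -/
theorem RingTheory.Sequence.IsWeaklyRegular.of_mem_ofList_sup_annihilator
    {A : Type*} [CommRing A] [IsLocalRing A] [IsNoetherianRing A] (xs : List A) :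
    ∀ {M : Type*} [AddCommGroup M] [Module A M] [Module.Finite A M] (ts : List A),
      ts.length = xs.length → (∀ x ∈ xs, x ∈ maximalIdeal A) → (∀ t ∈ ts, t ∈ maximalIdeal A) →
      IsWeaklyRegular M ts → (∀ t ∈ ts, t ∈ Ideal.ofList xs ⊔ annihilator A M) →
      IsWeaklyRegular M xs := by
  induction xs with
  | nil => intros; exact .nil A _
  | cons x xs ih =>
    intro M _ _ _ ts hlen hxs hts hreg hmem
    obtain rfl | ⟨ts, t, rfl⟩ := ts.eq_nil_or_concat
    · simp at hlen
    rw [List.concat_eq_append] at *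
    simp only [List.length_append, List.length_cons, List.length_nil, zero_add,
      Nat.add_right_cancel_iff] at hlen
    simp only [List.mem_append, List.mem_cons] at hxs hts hmem
    rw [isWeaklyRegular_append_iff, isWeaklyRegular_singleton_iff] at hreg
    obtain ⟨hts_reg, ht_reg⟩ := hreg
    let N := M ⧸ (Ideal.ofList ts • ⊤ : Submodule A M)
    obtain ⟨y, hy, hu⟩ := Ideal.exists_add_notMem_of_finset_prime
      (associatedPrimes.finite A N).toFinset (fun P hP => ((Set.Finite.mem_toFinset _).1 hP).isPrime)
      x (Ideal.ofList xs) (by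
        intro P hP hxP hle
        rw [Set.Finite.mem_toFinset] at hP
        have hann : annihilator A M ≤ P :=
          (LinearMap.annihilator_le_of_surjective (Submodule.mkQ _)
            (Submodule.mkQ_surjective _)).trans (Submodule.annihilator_top.ge.trans hP.annihilator_le)
        have htP : t ∈ P := by
          refine (sup_le ?_ hann) (hmem t (by simp))
          rw [Ideal.ofList_cons]
          exact sup_le ((Ideal.span_singleton_le_iff_mem _).2 hxP) hle
        have : t ∈ ⋃ p ∈ associatedPrimes A N, (p : Set A) := Set.mem_biUnion hP htP
        rw [biUnion_associatedPrimes_eq_compl_regular] at this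
        exact this ht_reg)
    have hxs_le : Ideal.ofList xs ≤ maximalIdeal A :=
      Ideal.span_le.2 fun r hr => hxs r (Or.inr hr)
    set u := x + y with hu_def
    have hu_max : u ∈ maximalIdeal A := add_mem (hxs x (Or.inl rfl)) (hxs_le hy)
    have hu_reg : IsSMulRegular N u := by
      by_contra hcon
      have : u ∈ ⋃ p ∈ associatedPrimes A N, (p : Set A) := by
        rw [biUnion_associatedPrimes_eq_compl_regular]; exact hcon
      obtain ⟨P, hP, huP⟩ := Set.mem_iUnion₂.1 this
      exact hu P ((Set.Finite.mem_toFinset _).2 hP) huP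
    have h1 : IsWeaklyRegular M (u :: ts) := by
      refine isWeaklyRegular_of_perm_of_subset_maximalIdeal (rs := ts ++ [u]) ?_
        (List.perm_append_singleton u ts) ?_
      · rw [isWeaklyRegular_append_iff, isWeaklyRegular_singleton_iff]
        exact ⟨hts_reg, hu_reg⟩
      · simp only [List.mem_append, List.mem_singleton]
        rintro r (hr | rfl)
        exacts [hts r (Or.inl hr), hu_max]
    rw [isWeaklyRegular_cons_iff] at h1
    have hu_ann : u ∈ annihilator A (QuotSMulTop u M) := by
      rw [mem_annihilator]
      intro m
      induction m using Submodule.Quotient.induction_on with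
      | H m =>
        rw [← Submodule.Quotient.mk_smul, Submodule.Quotient.mk_eq_zero]
        exact Submodule.smul_mem_pointwise_smul _ _ _ trivial
    have h2 : IsWeaklyRegular (QuotSMulTop u M) xs := by
      refine ih ts hlen (fun r hr => hxs r (Or.inr hr)) (fun r hr => hts r (Or.inl hr)) h1.2 ?_
      intro r hr
      suffices hle : Ideal.ofList (x :: xs) ⊔ annihilator A M ≤
          Ideal.ofList xs ⊔ annihilator A (QuotSMulTop u M) from hle (hmem r (Or.inl hr))
      refine sup_le ?_ ?_
      · rw [Ideal.ofList_cons]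
        refine sup_le ((Ideal.span_singleton_le_iff_mem _).2 ?_) le_sup_left
        have : x = u - y := by rw [hu_def]; ring
        rw [this]
        exact sub_mem (Ideal.mem_sup_right hu_ann) (Ideal.mem_sup_left hy)
      · exact (LinearMap.annihilator_le_of_surjective (Submodule.mkQ _)
            (Submodule.mkQ_surjective _)).trans le_sup_right
    have h3 : IsWeaklyRegular M (xs ++ [u]) := by
      refine isWeaklyRegular_of_perm_of_subset_maximalIdeal (rs := u :: xs)
        ((isWeaklyRegular_cons_iff _ _ _).2 ⟨h1.1, h2⟩)
        (List.perm_append_singleton u xs).symm ?_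
      simp only [List.mem_cons]
      rintro r (rfl | hr)
      exacts [hu_max, hxs r (Or.inr hr)]
    refine isWeaklyRegular_of_perm_of_subset_maximalIdeal (rs := xs ++ [x]) ?_
        (List.perm_append_singleton x xs) ?_
    · rw [isWeaklyRegular_append_iff, isWeaklyRegular_singleton_iff] at h3 ⊢
      refine ⟨h3.1, ?_⟩
      rw [isSMulRegular_quotient_iff_mem_of_smul_mem]
      intro m hm
      refine (isSMulRegular_quotient_iff_mem_of_smul_mem _ _).1 h3.2 m ?_
      rw [hu_def, add_smul]
      exact add_mem hm (Submodule.smul_mem_smul hy trivial)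
    · simp only [List.mem_append, List.mem_singleton]
      rintro r (hr | rfl)
      exacts [hxs r (Or.inr hr), hxs r (Or.inl rfl)]

end Exchange

section Complexes

variable {S : Type*} [CommRing S] {C : ℕ → Type*} [∀ i, AddCommGroup (C i)]
  [∀ i, Module S (C i)]

open RingTheory.Sequence

theorem Submodule.mem_sup_span_singleton_smul_top {M : Type*} [AddCommGroup M] [Module S M]
    {I : Ideal S} {s : S} {x : M} :
    x ∈ (I ⊔ Ideal.span {s}) • (⊤ : Submodule S M) ↔
      ∃ y, x - s • y ∈ I • (⊤ : Submodule S M) := by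
  rw [Submodule.sup_smul, Submodule.ideal_span_singleton_smul, Submodule.mem_sup]
  constructor
  · rintro ⟨q, hq, z, hz, rfl⟩
    obtain ⟨y, -, rfl⟩ := (Submodule.mem_smul_pointwise_iff_exists _ _ _).1 hz
    exact ⟨y, by simpa using hq⟩
  · rintro ⟨y, hy⟩
    exact ⟨_, hy, _, Submodule.smul_mem_pointwise_smul y s _ trivial, by simp⟩

theorem Ideal.ofList_take_succ (rs : List S) (r : ℕ) (hr : r < rs.length) :
    Ideal.ofList (rs.take (r + 1)) = Ideal.ofList (rs.take r) ⊔ Ideal.span {rs[r]} := by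
  rw [List.take_add_one, List.getElem?_eq_getElem hr, Ideal.ofList_append, Option.toList_some,
    Ideal.ofList_singleton]

/-- The complex `C / I C` is exact in all degrees greater than `a`. -/
def ExactModAbove (δ : ∀ i, C (i + 1) →ₗ[S] C i) (I : Ideal S) (a : ℕ) : Prop :=
  ∀ i, a ≤ i → ∀ x : C (i + 1), δ i x ∈ I • (⊤ : Submodule S (C i)) →
    x ∈ LinearMap.range (δ (i + 1)) ⊔ I • (⊤ : Submodule S (C (i + 1)))

variable {δ : ∀ i, C (i + 1) →ₗ[S] C i}

theorem LinearMap.apply_mem_smul_top {M N : Type*} [AddCommGroup M] [Module S M] [AddCommGroup N]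
    [Module S N] (f : M →ₗ[S] N) {I : Ideal S} {x : M} (hx : x ∈ I • (⊤ : Submodule S M)) :
    f x ∈ I • (⊤ : Submodule S N) :=
  Submodule.smul_top_le_comap_smul_top I f hx

theorem ExactModAbove.sup_span_singleton (hδ : ∀ i, Function.Exact (δ (i + 1)) (δ i))
    {I : Ideal S} {a : ℕ} (h : ExactModAbove δ I a) {s : S}
    (hs : ∀ i, IsSMulRegular (C i ⧸ (I • ⊤ : Submodule S (C i))) s) :
    ExactModAbove δ (I ⊔ Ideal.span {s}) (a + 1) := by
  intro i hi x hx
  obtain ⟨i, rfl⟩ : ∃ j, i = j + 1 := ⟨i - 1, by omega⟩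
  obtain ⟨y, hy⟩ := Submodule.mem_sup_span_singleton_smul_top.1 hx
  have hdy : δ i y ∈ I • (⊤ : Submodule S (C i)) := by
    refine (isSMulRegular_quotient_iff_mem_of_smul_mem _ _).1 (hs i) _ ?_
    have := (δ i).apply_mem_smul_top hy
    rw [map_sub, (hδ i).apply_apply_eq_zero, map_smul, zero_sub, neg_mem_iff] at this
    exact this
  obtain ⟨_, ⟨v, rfl⟩, q, hq, hvq⟩ := Submodule.mem_sup.1 (h i (by omega) y hdy)
  have hxv : x - s • v ∈ LinearMap.range (δ (i + 2)) ⊔ I • (⊤ : Submodule S (C (i + 2))) := by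
    refine h (i + 1) (by omega) _ ?_
    have : δ (i + 1) (x - s • v) = (δ (i + 1) x - s • y) + s • q := by
      rw [← hvq, map_sub, map_smul, smul_add]; abel
    rw [this]
    exact add_mem hy (Submodule.smul_mem _ _ hq)
  obtain ⟨w, hw, q', hq', hwq⟩ := Submodule.mem_sup.1 hxv
  refine Submodule.mem_sup.2 ⟨w, hw, q' + s • v, ?_, by rw [← add_assoc, hwq]; abel⟩
  exact Submodule.mem_sup_span_singleton_smul_top.2 ⟨v, by simpa using hq'⟩

theorem exactModAbove_ofList_take (hδ : ∀ i, Function.Exact (δ (i + 1)) (δ i)) {rs : List S}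
    (hrs : ∀ i, IsWeaklyRegular (C i) rs) (r : ℕ) (hr : r ≤ rs.length) :
    ExactModAbove δ (Ideal.ofList (rs.take r)) r := by
  induction r with
  | zero =>
    intro i _ x hx
    rw [List.take_zero, Ideal.ofList_nil, Submodule.bot_smul, Submodule.mem_bot] at hx
    exact Submodule.mem_sup_left ((hδ i x).1 hx)
  | succ r ih =>
    rw [Ideal.ofList_take_succ rs r hr]
    exact (ih (by omega)).sup_span_singleton hδ fun i => (hrs i).regular_mod_prev r hr

/-- In a complex resolving a module in which `rs` annihilates the class of `z₀`, every
`rs.take r` supports a class in degree `r` that is again annihilated by `rs`, and that is fixed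
by a given idempotent chain endomorphism if `z₀` is. -/
theorem exists_notMem_range_sup_ofList_take (hδ : ∀ i, Function.Exact (δ (i + 1)) (δ i))
    {rs : List S} (hrs : ∀ i, IsWeaklyRegular (C i) rs) (π : ∀ i, C i →ₗ[S] C i)
    (hπδ : ∀ i x, δ i (π (i + 1) x) = π i (δ i x)) (hπ : ∀ i x, π i (π i x) = π i x)
    {z₀ : C 0} (hz₀ : π 0 z₀ = z₀) (hz₀_range : z₀ ∉ LinearMap.range (δ 0))
    (hz₀_smul : ∀ s ∈ rs, s • z₀ ∈ LinearMap.range (δ 0)) (r : ℕ) (hr : r ≤ rs.length) :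
    ∃ z : C r, π r z = z ∧
      z ∉ LinearMap.range (δ r) ⊔ Ideal.ofList (rs.take r) • (⊤ : Submodule S (C r)) ∧
      ∀ s ∈ rs, s • z ∈ LinearMap.range (δ r) ⊔
        Ideal.ofList (rs.take r) • (⊤ : Submodule S (C r)) := by
  induction r with
  | zero => exact ⟨z₀, hz₀, by simpa using hz₀_range, by simpa using hz₀_smul⟩
  | succ r ih =>
    obtain ⟨z, hz, hz_notMem, hz_smul⟩ := ih (by omega)
    have hE := exactModAbove_ofList_take hδ hrs r (by omega)
    have hs := (isSMulRegular_quotient_iff_mem_of_smul_mem _ _).1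
      ((hrs r).regular_mod_prev r hr)
    have hmem : rs[r] ∈ rs := List.getElem_mem hr
    rw [Ideal.ofList_take_succ rs r hr]
    generalize rs[r] = s at *
    generalize Ideal.ofList (rs.take r) = I at *
    obtain ⟨_, ⟨w₀, rfl⟩, q₀, hq₀, hw₀⟩ := Submodule.mem_sup.1 (hz_smul s hmem)
    have hw : δ r (π (r + 1) w₀) = s • z - π r q₀ := by
      rw [hπδ, eq_sub_iff_add_eq, ← map_add, hw₀, map_smul, hz]
    have hq := (π r).apply_mem_smul_top hq₀
    refine ⟨π (r + 1) w₀, hπ _ _, ?_, ?_⟩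
    · intro hcon
      obtain ⟨_, ⟨v, rfl⟩, p, hp, hvp⟩ := Submodule.mem_sup.1 hcon
      obtain ⟨y, hy⟩ := Submodule.mem_sup_span_singleton_smul_top.1 hp
      have h1 := (δ r).apply_mem_smul_top hy
      have h2 : δ r p = s • z - π r q₀ := by
        rw [← hw, ← hvp, map_add, (hδ r).apply_apply_eq_zero, zero_add]
      rw [map_sub, map_smul, h2] at h1
      have h3 : z - δ r y ∈ I • (⊤ : Submodule S (C r)) := by
        apply hs
        have : s • (z - δ r y) = (s • z - π r q₀ - s • δ r y) + π r q₀ := by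
          rw [smul_sub]; abel
        rw [this]
        exact add_mem h1 hq
      exact hz_notMem (Submodule.mem_sup.2 ⟨δ r y, ⟨y, rfl⟩, _, h3, by abel⟩)
    · intro t ht
      obtain ⟨_, ⟨w', rfl⟩, q', hq', hw'⟩ := Submodule.mem_sup.1 (hz_smul t ht)
      have h1 : δ r (t • π (r + 1) w₀ - s • w') ∈ I • (⊤ : Submodule S (C r)) := by
        have : δ r (t • π (r + 1) w₀ - s • w') = s • q' - t • π r q₀ := by
          rw [map_sub, map_smul, map_smul, hw, eq_sub_iff_add_eq.2 hw', smul_sub, smul_sub,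
            smul_comm t s z]
          abel
        rw [this]
        exact sub_mem (Submodule.smul_mem _ _ hq') (Submodule.smul_mem _ _ hq)
      obtain ⟨v, hv, p, hp, hvp⟩ := Submodule.mem_sup.1 (hE r le_rfl _ h1)
      refine Submodule.mem_sup.2 ⟨v, hv, p + s • w', ?_, by rw [← add_assoc, hvp]; abel⟩
      exact Submodule.mem_sup_span_singleton_smul_top.2 ⟨w', by simpa using hp⟩

end Complexes

section FreeComplexes

open RingTheory.Sequence

theorem Finsupp.mem_smul_top_iff {A ι : Type*} [CommRing A] {I : Ideal A} {f : ι →₀ A} :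
    f ∈ I • (⊤ : Submodule A (ι →₀ A)) ↔ ∀ p, f p ∈ I := by
  constructor
  · intro hf p
    have := (Finsupp.lapply (R := A) (M := A) p).apply_mem_smul_top hf
    rwa [smul_eq_mul, Ideal.mul_top] at this
  · intro hf
    rw [← f.sum_single]
    refine Submodule.sum_mem _ fun p _ => ?_
    rw [← mul_one (f p), ← smul_eq_mul, ← Finsupp.smul_single]
    exact Submodule.smul_mem_smul (hf p) trivial

theorem RingTheory.Sequence.IsWeaklyRegular.of_flat_module {A M : Type*} [CommRing A]
    [AddCommGroup M] [Module A M] [Module.Flat A M] {rs : List A} (h : IsWeaklyRegular A rs) :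
    IsWeaklyRegular M rs :=
  ((TensorProduct.rid A M).isWeaklyRegular_congr rs).1 h.isWeaklyRegular_lTensor

/-- In a minimal exact complex of free modules over a Noetherian ring, if a prime ideal contains
elements `ss` whose ideal contains a weakly regular sequence of the same length, then no basis
element of homological degree greater than the length of `ss` is a cycle modulo `ss`. -/
theorem apply_single_notMem_ofList_smul_top {A : Type*} [CommRing A] [IsNoetherianRing A]
    (P : Ideal A) [P.IsPrime] {ι : ℕ → Type*} (δ : ∀ i, (ι (i + 1) →₀ A) →ₗ[A] (ι i →₀ A))
    (hδ : ∀ i, Function.Exact (δ (i + 1)) (δ i))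
    (hmin : ∀ i, LinearMap.range (δ i) ≤ P • (⊤ : Submodule A (ι i →₀ A)))
    {rs ss : List A} (hlen : rs.length = ss.length) (hrs : IsWeaklyRegular A rs)
    (hss : ∀ s ∈ ss, s ∈ P) (hrs_mem : ∀ r ∈ rs, r ∈ Ideal.ofList ss) {i : ℕ}
    (hi : ss.length ≤ i) (p : ι (i + 1)) :
    δ i (Finsupp.single p 1) ∉ Ideal.ofList ss • (⊤ : Submodule A (ι i →₀ A)) := by
  intro hmem
  let S := Localization.AtPrime P
  let f := algebraMap A S
  let L (i : ℕ) := LocalizedModule.mkLinearMap P.primeCompl (ι i →₀ A)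
  let ε (i : ℕ) : LocalizedModule P.primeCompl (ι (i + 1) →₀ A) →ₗ[S]
      LocalizedModule P.primeCompl (ι i →₀ A) :=
    IsLocalizedModule.mapExtendScalars P.primeCompl (L (i + 1)) (L i) S (δ i)
  have hε_apply (i : ℕ) (x : ι (i + 1) →₀ A) : ε i (L (i + 1) x) = L i (δ i x) :=
    IsLocalizedModule.map_apply P.primeCompl (L (i + 1)) (L i) (δ i) x
  have hε (i : ℕ) : Function.Exact (ε (i + 1)) (ε i) :=
    IsLocalizedModule.map_exact P.primeCompl (L (i + 2)) (L (i + 1)) (L i) _ _ (hδ i)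
  have hf_mem {a : A} (ha : a ∈ P) : f a ∈ IsLocalRing.maximalIdeal S :=
    (IsLocalization.AtPrime.to_map_mem_maximal_iff S P a).2 ha
  have hss_le : Ideal.ofList ss ≤ P := Ideal.span_le.2 hss
  have hreg : IsWeaklyRegular S (ss.map f) := by
    refine IsWeaklyRegular.of_mem_ofList_sup_annihilator (ss.map f) (rs.map f)
      (by simpa using hlen) ?_ ?_ (hrs.of_isLocalization S P.primeCompl) ?_
    · simp only [List.mem_map, forall_exists_index, and_imp, forall_apply_eq_imp_iff₂]
      exact fun a ha => hf_mem (hss a ha)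
    · simp only [List.mem_map, forall_exists_index, and_imp, forall_apply_eq_imp_iff₂]
      exact fun a ha => hf_mem (hss_le (hrs_mem a ha))
    · simp only [List.mem_map, forall_exists_index, and_imp, forall_apply_eq_imp_iff₂]
      intro a ha
      rw [← Ideal.map_ofList]
      exact Ideal.mem_sup_left (Ideal.mem_map_of_mem f (hrs_mem a ha))
  have hE : ExactModAbove (C := fun i => LocalizedModule P.primeCompl (ι i →₀ A)) ε
      (Ideal.ofList (ss.map f)) ss.length := by
    have := exactModAbove_ofList_take
      (C := fun i => LocalizedModule P.primeCompl (ι i →₀ A)) (δ := ε) hε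
      (fun i => hreg.of_flat_module (M := LocalizedModule P.primeCompl (ι i →₀ A)))
      ss.length (by simp)
    rwa [List.take_of_length_le (by simp)] at this
  have hcycle : ε i (L (i + 1) (Finsupp.single p 1)) ∈ Ideal.ofList (ss.map f) •
      (⊤ : Submodule S (LocalizedModule P.primeCompl (ι i →₀ A))) := by
    rw [hε_apply, ← Ideal.map_ofList]
    refine Submodule.smul_induction_on hmem (fun a ha x _ => ?_) fun x y hx hy => ?_
    · rw [map_smul, ← algebraMap_smul S a]
      exact Submodule.smul_mem_smul (Ideal.mem_map_of_mem f ha) trivial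
    · rw [map_add]
      exact add_mem hx hy
  let φ : LocalizedModule P.primeCompl (ι (i + 1) →₀ A) →ₗ[S] S :=
    IsLocalizedModule.mapExtendScalars P.primeCompl (L (i + 1)) (Algebra.linearMap A S) S
      (Finsupp.lapply p)
  have hφ_apply (x : ι (i + 1) →₀ A) : φ (L (i + 1) x) = f (x p) :=
    IsLocalizedModule.map_apply P.primeCompl (L (i + 1)) (Algebra.linearMap A S)
      (Finsupp.lapply p) x
  obtain ⟨_, ⟨y, rfl⟩, q, hq, hyq⟩ := Submodule.mem_sup.1 (hE i hi _ hcycle)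
  have hφq : φ q ∈ IsLocalRing.maximalIdeal S := by
    have := φ.apply_mem_smul_top hq
    rw [smul_eq_mul, Ideal.mul_top] at this
    rw [← Ideal.map_ofList] at this
    have hle : (Ideal.ofList ss).map f ≤ IsLocalRing.maximalIdeal S :=
      Ideal.map_le_iff_le_comap.2 fun a ha => hf_mem (hss_le ha)
    exact hle this
  have hφy : φ (ε (i + 1) y) ∈ IsLocalRing.maximalIdeal S := by
    obtain ⟨⟨x, u⟩, hx⟩ := IsLocalizedModule.surj P.primeCompl (L (i + 2)) y
    have hx' : f u * φ (ε (i + 1) y) = f (δ (i + 1) x p) := by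
      rw [← hφ_apply, ← hε_apply, ← hx, ← smul_eq_mul, ← map_smul, ← map_smul]
      congr 2
      exact algebraMap_smul S (u : A) y
    have hmem' : f u * φ (ε (i + 1) y) ∈ IsLocalRing.maximalIdeal S := by
      rw [hx']
      exact hf_mem (Finsupp.mem_smul_top_iff.1 (hmin (i + 1) ⟨x, rfl⟩) p)
    exact ((Ideal.IsPrime.mem_or_mem inferInstance hmem').resolve_left fun hu =>
      u.2 ((IsLocalization.AtPrime.to_map_mem_maximal_iff S P (u : A)).1 hu))
  have h1 : (1 : S) ∈ IsLocalRing.maximalIdeal S := by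
    have : φ (ε (i + 1) y) + φ q = 1 := by
      rw [← map_add, hyq, hφ_apply, Finsupp.single_eq_same, map_one]
    rw [← this]
    exact add_mem hφy hφq
  exact (Ideal.ne_top_iff_one _).1 (IsLocalRing.maximalIdeal.isMaximal S).ne_top h1

end FreeComplexes

section Graded

variable {R₀ : Type} [CommRing R₀] {R : Type} [CommRing R] [Algebra R₀ R]
variable {𝒜 : ℤ → Submodule R₀ R}

open IsLocalRing

namespace IsStandardGraded

theorem exists_algebraMap_eq (hstd : IsStandardGraded R₀ R 𝒜) {y : R} (hy : y ∈ 𝒜 0) :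
    ∃ a, algebraMap R₀ R a = y := by
  rw [hstd.2.1] at hy
  exact Submodule.mem_one.1 hy

theorem algebraMap_mem_gradedMax [IsLocalRing R₀] {a : R₀} (ha : a ∈ maximalIdeal R₀) :
    algebraMap R₀ R a ∈ gradedMax R₀ R 𝒜 :=
  Ideal.mem_sup_right (Ideal.subset_span ⟨a, ha, rfl⟩)

variable [GradedAlgebra 𝒜]

theorem exists_proj_zero_eq (hstd : IsStandardGraded R₀ R 𝒜) (y : R) :
    ∃ a, algebraMap R₀ R a = GradedAlgebra.proj 𝒜 0 y :=
  hstd.exists_algebraMap_eq (SetLike.coe_mem (DirectSum.decompose 𝒜 y 0))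

theorem proj_zero_of_mem {n : ℤ} {x : R} (hx : x ∈ 𝒜 n) :
    GradedAlgebra.proj 𝒜 0 x = if n = 0 then x else 0 := by
  rw [GradedAlgebra.proj_apply]
  split_ifs with h
  · subst h
    exact DirectSum.decompose_of_mem_same 𝒜 hx
  · exact DirectSum.decompose_of_mem_ne 𝒜 hx h

variable [IsLocalRing R₀]

theorem sub_proj_zero_mem_gradedMax (hstd : IsStandardGraded R₀ R 𝒜) (x : R) :
    x - GradedAlgebra.proj 𝒜 0 x ∈ gradedMax R₀ R 𝒜 := by
  induction x using DirectSum.Decomposition.inductionOn 𝒜 with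
  | zero => simp
  | @homogeneous n x =>
    obtain ⟨x, hx⟩ := x
    change x - GradedAlgebra.proj 𝒜 0 x ∈ gradedMax R₀ R 𝒜
    rw [proj_zero_of_mem hx]
    split_ifs with h
    · simp
    · rw [sub_zero]
      rcases lt_or_gt_of_ne h with h | h
      · rw [hstd.1 n h, Submodule.mem_bot] at hx
        rw [hx]
        exact zero_mem _
      · exact Ideal.mem_sup_left (Ideal.subset_span (Set.mem_iUnion.2 ⟨⟨n, h⟩, hx⟩))
  | add x y hx hy =>
    rw [map_add, add_sub_add_comm]
    exact add_mem hx hy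

theorem proj_zero_of_mem_gradedMax (hstd : IsStandardGraded R₀ R 𝒜) {y : R}
    (hy : y ∈ gradedMax R₀ R 𝒜) :
    ∃ a ∈ maximalIdeal R₀, algebraMap R₀ R a = GradedAlgebra.proj 𝒜 0 y := by
  let N : Submodule R₀ R := Submodule.map (Algebra.linearMap R₀ R) (maximalIdeal R₀)
  suffices h : ∀ r, GradedAlgebra.proj 𝒜 0 (r * y) ∈ N by
    obtain ⟨a, ha, hay⟩ := h 1
    exact ⟨a, ha, by simpa using hay⟩
  rw [gradedMax, irrelevant, ← Ideal.span_union] at hy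
  induction hy using Submodule.span_induction with
  | zero => simp
  | add x y _ _ hx hy =>
    intro r
    rw [mul_add, map_add]
    exact add_mem (hx r) (hy r)
  | smul b x _ hx =>
    intro r
    rw [smul_eq_mul, ← mul_assoc]
    exact hx _
  | mem x hx =>
    intro r
    obtain hx | ⟨a, ha, rfl⟩ := hx
    · obtain ⟨⟨n, hn⟩, hx⟩ := Set.mem_iUnion.1 hx
      change x ∈ 𝒜 n at hx
      suffices GradedAlgebra.proj 𝒜 0 (r * x) = 0 by rw [this]; exact zero_mem _
      induction r using DirectSum.Decomposition.inductionOn 𝒜 with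
      | zero => simp
      | @homogeneous m r =>
        obtain ⟨r, hr⟩ := r
        rw [proj_zero_of_mem (SetLike.GradedMul.mul_mem hr hx)]
        split_ifs with h
        · rw [hstd.1 m (by omega), Submodule.mem_bot] at hr
          rw [hr, zero_mul]
        · rfl
      | add r s hr hs => rw [add_mul, map_add, hr, hs, add_zero]
    · obtain ⟨b, hb⟩ := hstd.exists_proj_zero_eq r
      rw [mul_comm, ← Algebra.smul_def, map_smul, ← hb, Algebra.smul_def, ← map_mul]
      exact ⟨a * b, Ideal.mul_mem_right b _ ha, rfl⟩

theorem isMaximal_gradedMax [Nontrivial R] (hstd : IsStandardGraded R₀ R 𝒜) :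
    (gradedMax R₀ R 𝒜).IsMaximal := by
  rw [Ideal.isMaximal_iff]
  constructor
  · intro h1
    obtain ⟨a, ha, ha1⟩ := hstd.proj_zero_of_mem_gradedMax h1
    rw [proj_zero_of_mem (SetLike.GradedOne.one_mem (A := 𝒜)), if_pos rfl] at ha1
    have hu : IsUnit (1 - a) := by
      by_contra hcon
      exact (Ideal.ne_top_iff_one _).1 (maximalIdeal.isMaximal R₀).ne_top
        (by simpa using add_mem ((mem_maximalIdeal _).2 hcon) ha)
    have := hu.map (algebraMap R₀ R)
    rw [map_sub, map_one, ha1, sub_self] at this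
    exact not_isUnit_zero this
  · intro J x hJ hx hxJ
    obtain ⟨a, ha⟩ := hstd.exists_proj_zero_eq x
    have hsub := hstd.sub_proj_zero_mem_gradedMax x
    rw [← ha] at hsub
    have hu : IsUnit a := by
      by_contra hcon
      refine hx ?_
      rw [← sub_add_cancel x (algebraMap R₀ R a)]
      exact add_mem hsub (algebraMap_mem_gradedMax ((mem_maximalIdeal _).2 hcon))
    have haJ : algebraMap R₀ R a ∈ J := by
      rw [← sub_sub_cancel x (algebraMap R₀ R a)]
      exact sub_mem hxJ (hJ hsub)
    exact (Ideal.eq_top_iff_one _).1 (J.eq_top_of_isUnit_mem haJ (hu.map _))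

end IsStandardGraded

variable [GradedAlgebra 𝒜]

theorem single_one_mem_stdFreeGrading {β : ℤ → ℕ} (p : Σ j : ℤ, Fin (β j)) :
    Finsupp.single p 1 ∈ stdFreeGrading R₀ R 𝒜 β p.1 := by
  intro q
  by_cases h : p = q
  · subst h
    rw [Finsupp.single_eq_same, sub_self]
    exact SetLike.GradedOne.one_mem
  · rw [Finsupp.single_eq_of_ne' h]
    exact zero_mem _

variable (𝒜) in
/-- The projection of a graded free module onto its component of degree `0`. -/
def stdFreeProjZero (β : ℤ → ℕ) : stdFree R β →ₗ[R₀] stdFree R β :=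
  Finsupp.lsum R₀ fun p => Finsupp.lsingle p ∘ₗ GradedAlgebra.proj 𝒜 (0 - p.1)

theorem stdFreeProjZero_apply {β : ℤ → ℕ} (f : stdFree R β) (q : Σ j : ℤ, Fin (β j)) :
    stdFreeProjZero 𝒜 β f q = GradedAlgebra.proj 𝒜 (0 - q.1) (f q) := by
  induction f using Finsupp.induction_linear with
  | zero => simp
  | add f g hf hg => rw [map_add, Finsupp.add_apply, hf, hg, Finsupp.add_apply, map_add]
  | single p a =>
    rw [stdFreeProjZero, Finsupp.lsum_single, LinearMap.comp_apply, Finsupp.lsingle_apply]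
    by_cases h : p = q
    · subst h
      rw [Finsupp.single_eq_same, Finsupp.single_eq_same]
    · rw [Finsupp.single_eq_of_ne' h, Finsupp.single_eq_of_ne' h, map_zero]

theorem stdFreeProjZero_mem {β : ℤ → ℕ} (f : stdFree R β) :
    stdFreeProjZero 𝒜 β f ∈ stdFreeGrading R₀ R 𝒜 β 0 := fun q => by
  rw [stdFreeProjZero_apply, GradedAlgebra.proj_apply]
  exact SetLike.coe_mem _

theorem stdFreeProjZero_of_mem {β : ℤ → ℕ} {n : ℤ} {f : stdFree R β}
    (hf : f ∈ stdFreeGrading R₀ R 𝒜 β n) :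
    stdFreeProjZero 𝒜 β f = if n = 0 then f else 0 := by
  ext q
  rw [stdFreeProjZero_apply, GradedAlgebra.proj_apply]
  split_ifs with h
  · subst h
    exact DirectSum.decompose_of_mem_same 𝒜 (hf q)
  · exact DirectSum.decompose_of_mem_ne 𝒜 (hf q) (by omega)

theorem map_stdFreeProjZero {β γ : ℤ → ℕ} (δ : stdFree R β →ₗ[R] stdFree R γ)
    (hδ : ∀ n x, x ∈ stdFreeGrading R₀ R 𝒜 β n → δ x ∈ stdFreeGrading R₀ R 𝒜 γ n)
    (x : stdFree R β) : δ (stdFreeProjZero 𝒜 β x) = stdFreeProjZero 𝒜 γ (δ x) := by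
  have hom {n : ℤ} {x : stdFree R β} (hx : x ∈ stdFreeGrading R₀ R 𝒜 β n) :
      δ (stdFreeProjZero 𝒜 β x) = stdFreeProjZero 𝒜 γ (δ x) := by
    rw [stdFreeProjZero_of_mem hx, stdFreeProjZero_of_mem (hδ n x hx)]
    split_ifs <;> simp
  induction x using Finsupp.induction_linear with
  | zero => simp
  | add f g hf hg => rw [map_add, map_add, hf, hg, map_add, map_add]
  | single p a =>
    induction a using DirectSum.Decomposition.inductionOn 𝒜 with
    | zero => simp
    | add a b ha hb => rw [Finsupp.single_add, map_add, map_add, ha, hb, map_add, map_add]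
    | @homogeneous m a =>
      refine hom (n := m + p.1) fun q => ?_
      by_cases h : p = q
      · subst h
        rw [Finsupp.single_eq_same, add_sub_cancel_right]
        exact a.2
      · rw [Finsupp.single_eq_of_ne' h]
        exact zero_mem _

end Graded

section MinimalResolution

open IsLocalRing RingTheory.Sequence

variable {R₀ : Type} [CommRing R₀] [IsLocalRing R₀] {R : Type} [CommRing R] [Algebra R₀ R]
variable {𝒜 : ℤ → Submodule R₀ R} [GradedAlgebra 𝒜]

namespace MinGradedFreeRes

theorem single_one_notMem_range_d [Nontrivial R] (hstd : IsStandardGraded R₀ R 𝒜)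
    {M : Type} [AddCommGroup M] [Module R M] [Module R₀ M] {ℳ : ℤ → Submodule R₀ M}
    (F : MinGradedFreeRes R₀ R 𝒜 M (gradedMax R₀ R 𝒜) ℳ) (i : ℕ)
    (p : Σ j : ℤ, Fin (F.β i j)) : Finsupp.single p 1 ∉ LinearMap.range (F.d i) := by
  intro hp
  have := Finsupp.mem_smul_top_iff.1 (F.minimal i hp) p
  rw [Finsupp.single_eq_same] at this
  exact (Ideal.ne_top_iff_one _).1 hstd.isMaximal_gradedMax.ne_top this

variable (F : MinGradedFreeRes R₀ R 𝒜 (resField R₀ R 𝒜) (gradedMax R₀ R 𝒜)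
  (resFieldGrading R₀ R 𝒜))

theorem degree_eq_zero [Nontrivial R] (hstd : IsStandardGraded R₀ R 𝒜)
    (p : Σ j : ℤ, Fin (F.β 0 j)) : p.1 = 0 := by
  by_contra h
  refine F.single_one_notMem_range_d hstd 0 p ((F.exact_aug _).1 ?_)
  have := F.graded_aug p.1 _ (single_one_mem_stdFreeGrading p)
  rwa [resFieldGrading, if_neg h, Submodule.mem_bot] at this

theorem sub_le_degree [IsNoetherianRing R] [Nontrivial R] (hstd : IsStandardGraded R₀ R 𝒜)
    {ss : List R₀} (hss : Ideal.ofList ss = maximalIdeal R₀) {rs : List R₀}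
    (hlen : rs.length = ss.length) (hrs : ∀ r ∈ rs, r ∈ maximalIdeal R₀)
    (hreg : IsWeaklyRegular R rs) (i : ℕ) (p : Σ j : ℤ, Fin (F.β i j)) :
    0 ≤ p.1 ∧ (i : ℤ) - ss.length ≤ p.1 := by
  have := hstd.isMaximal_gradedMax.isPrime
  induction i with
  | zero =>
    rw [F.degree_eq_zero hstd p]
    simp
  | succ i ih =>
    have hcoord := F.graded_d i p.1 _ (single_one_mem_stdFreeGrading p)
    have hneg {q : Σ j : ℤ, Fin (F.β i j)} (hq : p.1 < q.1) :
        F.d i (Finsupp.single p 1) q = 0 := by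
      have := hcoord q
      rwa [hstd.1 _ (by omega), Submodule.mem_bot] at this
    have h0 : 0 ≤ p.1 := by
      by_contra! h0
      refine F.single_one_notMem_range_d hstd (i + 1) p ((F.exact i _).1 ?_)
      ext q
      exact hneg (h0.trans_le (ih q).1)
    refine ⟨h0, ?_⟩
    by_contra! h1
    push_cast at h1
    refine apply_single_notMem_ofList_smul_top (gradedMax R₀ R 𝒜)
      (ι := fun i => Σ j : ℤ, Fin (F.β i j)) F.d F.exact F.minimal
      (rs := rs.map (algebraMap R₀ R)) (ss := ss.map (algebraMap R₀ R)) (by simpa using hlen)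
      ((isWeaklyRegular_map_algebraMap_iff R R rs).2 hreg) ?_ ?_ (i := i)
      (by rw [List.length_map]; omega) p ?_
    · simp only [List.mem_map, forall_exists_index, and_imp, forall_apply_eq_imp_iff₂]
      exact fun s hs => IsStandardGraded.algebraMap_mem_gradedMax
        (hss ▸ Ideal.subset_span hs)
    · simp only [List.mem_map, forall_exists_index, and_imp, forall_apply_eq_imp_iff₂]
      intro r hr
      rw [← Ideal.map_ofList, hss]
      exact Ideal.mem_map_of_mem _ (hrs r hr)
    · rw [Finsupp.mem_smul_top_iff]
      intro q
      rcases lt_or_ge p.1 q.1 with hq | hq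
      · rw [hneg hq]
        exact zero_mem _
      · have hpq : p.1 - q.1 = 0 := by have := (ih q).2; omega
        have hq0 := hcoord q
        rw [hpq] at hq0
        have hmax := Finsupp.mem_smul_top_iff.1 (F.minimal i ⟨Finsupp.single p 1, rfl⟩) q
        obtain ⟨a, ha, haq⟩ := hstd.proj_zero_of_mem_gradedMax hmax
        rw [IsStandardGraded.proj_zero_of_mem hq0, if_pos rfl] at haq
        rw [← haq, ← Ideal.map_ofList, hss]
        exact Ideal.mem_map_of_mem _ ha

theorem exists_aug_single_ne_zero [Nontrivial R] (hstd : IsStandardGraded R₀ R 𝒜) :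
    ∃ p : Σ j : ℤ, Fin (F.β 0 j), F.aug (Finsupp.single p 1) ≠ 0 := by
  by_contra! h
  have haug : F.aug = 0 := by
    ext p
    simpa using h p
  have := Ideal.Quotient.nontrivial_iff.2 (hstd.isMaximal_gradedMax).ne_top
  obtain ⟨x, hx⟩ := F.aug_surj 1
  rw [haug, LinearMap.zero_apply] at hx
  exact zero_ne_one hx

theorem betti_length_zero_ne_zero [Nontrivial R] (hstd : IsStandardGraded R₀ R 𝒜)
    (hnonneg : ∀ i (p : Σ j : ℤ, Fin (F.β i j)), 0 ≤ p.1) {rs : List R₀}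
    (hrs : ∀ r ∈ rs, r ∈ maximalIdeal R₀) (hreg : IsWeaklyRegular R rs) :
    F.β rs.length 0 ≠ 0 := by
  intro hβ
  have hfree (i : ℕ) : IsWeaklyRegular (stdFree R (F.β i)) rs := by
    rw [← isWeaklyRegular_map_algebraMap_iff R (stdFree R (F.β i)) rs]
    exact ((isWeaklyRegular_map_algebraMap_iff R R rs).2 hreg).of_flat_module
  obtain ⟨p, hp⟩ := F.exists_aug_single_ne_zero hstd
  obtain ⟨z, hz, hz_notMem, -⟩ := exists_notMem_range_sup_ofList_take
    (C := fun i => stdFree R (F.β i)) (δ := fun i => (F.d i).restrictScalars R₀) F.exact hfree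
    (fun i => stdFreeProjZero 𝒜 (F.β i))
    (fun i x => map_stdFreeProjZero (F.d i) (F.graded_d i) x)
    (fun i x => by rw [stdFreeProjZero_of_mem (stdFreeProjZero_mem x), if_pos rfl])
    (z₀ := Finsupp.single p 1)
    (by rw [stdFreeProjZero_of_mem (single_one_mem_stdFreeGrading p),
      if_pos (F.degree_eq_zero hstd p)])
    (fun h => hp ((F.exact_aug _).2 h))
    (fun s hs => (F.exact_aug _).1 (by
      rw [← algebraMap_smul R s, map_smul]
      obtain ⟨y, hy⟩ := Ideal.Quotient.mk_surjective (F.aug (Finsupp.single p 1))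
      rw [← hy]
      exact Ideal.Quotient.eq_zero_iff_mem.2
        (Ideal.mul_mem_right y _ (IsStandardGraded.algebraMap_mem_gradedMax (hrs s hs)))))
    rs.length le_rfl
  refine hz_notMem ?_
  have hz0 : z = 0 := by
    have hz_mem := stdFreeProjZero_mem (𝒜 := 𝒜) z
    rw [hz] at hz_mem
    ext q
    have hq : q.1 ≠ 0 := by
      rintro h
      have := q.2.pos
      rw [h] at this
      omega
    have hq' := hz_mem q
    have := hnonneg _ q
    rwa [hstd.1 _ (by omega), Submodule.mem_bot] at hq'
  rw [hz0]
  exact zero_mem _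

end MinGradedFreeRes

end MinimalResolution

/-- If `R₀` is regular local of dimension `d` and `m₀` contains an `R`-regular sequence of
length `d`, then `reg_R(k,k) = d`, read off from a minimal graded free resolution of `k`:
`reg_R(k,k) = sup_i {i − indeg Tor_i^R(k,k)} = sup {i − j | β_{ij}(k) ≠ 0}`. -/
theorem stmt3 (R₀ : Type) [CommRing R₀] [IsLocalRing R₀] (d : ℕ)
    (hreg : IsRegularLocal R₀ d)
    (R : Type) [CommRing R] [Algebra R₀ R] [IsNoetherianRing R]
    (𝒜 : ℤ → Submodule R₀ R) [GradedAlgebra 𝒜] (hstd : IsStandardGraded R₀ R 𝒜)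
    (hseq : ∃ rs : List R, rs.length = d ∧
        (∀ r ∈ rs, ∃ x ∈ IsLocalRing.maximalIdeal R₀, algebraMap R₀ R x = r) ∧
        RingTheory.Sequence.IsRegular R rs)
    (F : MinGradedFreeRes R₀ R 𝒜 (resField R₀ R 𝒜) (gradedMax R₀ R 𝒜)
      (resFieldGrading R₀ R 𝒜)) :
    IsGreatest (regSet R₀ R 𝒜 _ F) (d : ℤ) := by
  obtain ⟨-, -, s, hs_card, hs_span⟩ := hreg
  obtain ⟨rs, hlen, hrs, hreg⟩ := hseq
  obtain ⟨ts, hts, rfl⟩ : ∃ ts : List R₀, (∀ t ∈ ts, t ∈ IsLocalRing.maximalIdeal R₀) ∧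
      ts.map (algebraMap R₀ R) = rs := by
    choose! f hf hf' using hrs
    refine ⟨rs.map f, by simpa using hf, ?_⟩
    rw [List.map_map]
    exact (List.map_congr_left hf').trans rs.map_id
  have := hreg.nontrivial
  rw [List.length_map] at hlen
  have hts_reg := (RingTheory.Sequence.isWeaklyRegular_map_algebraMap_iff R R ts).1
    hreg.toIsWeaklyRegular
  have hss : Ideal.ofList s.toList = IsLocalRing.maximalIdeal R₀ := by
    rw [← hs_span, Ideal.ofList]
    congr 1
    ext
    simp
  have hs_length : s.toList.length = d := by rw [Finset.length_toList, hs_card]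
  have hdeg := F.sub_le_degree hstd hss (hlen.trans hs_length.symm) hts hts_reg
  rw [hs_length] at hdeg
  constructor
  · refine ⟨d, 0, ?_, by simp⟩
    rw [← hlen]
    exact F.betti_length_zero_ne_zero hstd (fun i p => (hdeg i p).1) hts hts_reg
  · rintro _ ⟨i, j, hβ, rfl⟩
    have := (hdeg i ⟨j, ⟨0, Nat.pos_of_ne_zero hβ⟩⟩).2
    linarith
end
end

section
/- Let S be a polynomial ring over a regular local ring R₀, f: S → R a surjective graded homomorphism with kernel I satisfying indeg(I) ≥ dim(R₀) + 1, and let k be the residue field of R₀. Then reg_R(k,k) = reg_S(k,k) = dim R₀. -/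
open DirectSum CategoryTheory CategoryTheory.Limits Opposite

noncomputable section
/-- The standard grading of the polynomial ring `R₀[X₁,…,Xₘ]`, indexed by `ℤ`. -/
def mvGrading (R₀ : Type) [CommRing R₀] (m : ℕ) (z : ℤ) :
    Submodule R₀ (MvPolynomial (Fin m) R₀) :=
  if 0 ≤ z then MvPolynomial.homogeneousSubmodule (Fin m) R₀ z.toNat else ⊥

section RegularChain

/-- `J` is obtained from `I` by successively adjoining `n` elements, each of them a
nonzerodivisor modulo the ideal generated so far. -/
inductive RegularChain {A : Type*} [CommRing A] : Ideal A → Ideal A → ℕ → Prop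
  | nil (I : Ideal A) : RegularChain I I 0
  | cons {I J : Ideal A} {n : ℕ} (x : A) (hx : ∀ y, x * y ∈ I → y ∈ I)
      (h : RegularChain (I ⊔ Ideal.span {x}) J n) : RegularChain I J (n + 1)

lemma mem_sup_span_singleton {A : Type*} [CommRing A] {I : Ideal A} {x y : A} :
    y ∈ I ⊔ Ideal.span {x} ↔ ∃ w, y - x * w ∈ I := by
  rw [sup_comm, Ideal.mem_span_singleton_sup]
  constructor
  · rintro ⟨a, b, hb, rfl⟩
    exact ⟨a, by convert hb using 1; ring⟩
  · rintro ⟨w, hw⟩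
    exact ⟨w, _, hw, by ring⟩

lemma RegularChain.comap {A B : Type*} [CommRing A] [CommRing B] (φ : A →+* B)
    (hφ : Function.Surjective φ) {I J : Ideal B} {n : ℕ} (h : RegularChain I J n) :
    RegularChain (I.comap φ) (J.comap φ) n := by
  induction h with
  | nil I => exact .nil _
  | @cons I J n x hx _ ih =>
    obtain ⟨x, rfl⟩ := hφ x
    refine .cons x (fun y hy => hx _ (by simpa using hy)) ?_
    convert ih using 1
    ext y
    rw [Ideal.mem_comap, mem_sup_span_singleton, mem_sup_span_singleton]
    constructor
    · rintro ⟨w, hw⟩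
      exact ⟨φ w, by simpa using hw⟩
    · rintro ⟨w, hw⟩
      obtain ⟨w, rfl⟩ := hφ w
      exact ⟨w, by simpa using hw⟩

/-- A principal prime ideal whose generator lies in no minimal prime forces a Noetherian local
ring to be a domain. -/
lemma isDomain_of_isPrime_span_singleton {A : Type*} [CommRing A] [IsLocalRing A]
    [IsNoetherianRing A] {x : A} (hx : x ∈ IsLocalRing.maximalIdeal A)
    [hp : (Ideal.span {x}).IsPrime] (hmin : ∀ P ∈ minimalPrimes A, x ∉ P) : IsDomain A := by
  obtain ⟨P, hP, hPle⟩ := Ideal.exists_minimalPrimes_le (I := (⊥ : Ideal A)) (J := Ideal.span {x})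
    bot_le
  have hPp : P.IsPrime := hP.1.1
  have hbot : P = ⊥ := by
    refine Submodule.eq_bot_of_le_smul_of_le_jacobson_bot (IsLocalRing.maximalIdeal A) P
      (IsNoetherian.noetherian P) (fun y hy => ?_) (IsLocalRing.maximalIdeal_le_jacobson _)
    obtain ⟨z, rfl⟩ := Ideal.mem_span_singleton.1 (hPle hy)
    exact Submodule.smul_mem_smul hx ((hPp.mem_or_mem hy).resolve_left (hmin P hP))
  have : (⊥ : Ideal A).IsPrime := hbot ▸ hPp
  exact IsDomain.of_bot_isPrime A

lemma exists_mem_maximalIdeal_notMem {A : Type*} [CommRing A] [IsLocalRing A]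
    [IsNoetherianRing A] (hd : 1 ≤ ringKrullDim A) :
    ∃ x ∈ IsLocalRing.maximalIdeal A, x ∉ IsLocalRing.maximalIdeal A ^ 2 ∧
      ∀ P ∈ minimalPrimes A, x ∉ P := by
  set m := IsLocalRing.maximalIdeal A with hm
  have hmin : ∀ P ∈ minimalPrimes A, ¬ m ≤ P := by
    intro P hP hle
    have hPp : P.IsPrime := hP.1.1
    have hPm : P = m := le_antisymm (IsLocalRing.le_maximalIdeal hPp.ne_top) hle
    have h0 : m.height = 0 := by
      rw [← hPm, Ideal.height_eq_zero_iff]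
      exact hP
    rw [← IsLocalRing.maximalIdeal_height_eq_ringKrullDim, ← hm, h0] at hd
    exact absurd hd (by decide)
  have hsq : ¬ m ≤ m ^ 2 := by
    intro hle
    have hbot : m = ⊥ := by
      refine Submodule.eq_bot_of_le_smul_of_le_jacobson_bot m m
        (IsNoetherian.noetherian m) ?_ (IsLocalRing.maximalIdeal_le_jacobson _)
      rwa [smul_eq_mul, ← sq]
    obtain ⟨P, hP, -⟩ := Ideal.exists_minimalPrimes_le (I := (⊥ : Ideal A)) (J := m) bot_le
    exact hmin P hP (hbot ▸ bot_le)
  have hfin := minimalPrimes.finite_of_isNoetherianRing A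
  by_contra! hcon
  have hsub : (m : Set A) ⊆ ⋃ i ∈ (↑(insert (m ^ 2) hfin.toFinset) : Set (Ideal A)), (i : Set A) := by
    intro x hx
    simp only [Finset.coe_insert, Set.Finite.coe_toFinset, Set.mem_iUnion, exists_prop]
    by_cases h2 : x ∈ m ^ 2
    · exact ⟨m ^ 2, Set.mem_insert _ _, h2⟩
    · obtain ⟨P, hP, hxP⟩ := hcon x hx h2
      exact ⟨P, Set.mem_insert_of_mem _ hP, hxP⟩
  rw [Ideal.subset_union_prime (m ^ 2) (m ^ 2)] at hsub
  · obtain ⟨P, hP, hle⟩ := hsub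
    rcases Finset.mem_insert.1 hP with rfl | hP
    · exact hsq hle
    · exact hmin P (by simpa using hP) hle
  · intro P hP hne _
    have := (Finset.mem_insert.1 hP).resolve_left hne
    have : P ∈ minimalPrimes A := by simpa using this
    exact this.1.1

/-- Exchange: an element outside `m²` can replace one of the given generators of `m`. -/
lemma exists_span_insert_erase {A : Type*} [CommRing A] [IsLocalRing A] [DecidableEq A]
    {s : Finset A} (hs : Ideal.span (s : Set A) = IsLocalRing.maximalIdeal A) {x : A}
    (hx : x ∈ IsLocalRing.maximalIdeal A) (hx2 : x ∉ IsLocalRing.maximalIdeal A ^ 2) :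
    ∃ a ∈ s, IsLocalRing.maximalIdeal A = Ideal.span (insert x (s.erase a : Set A)) := by
  have hxs : x ∈ Submodule.span A (s : Set A) := hs.ge hx
  obtain ⟨c, -, hc⟩ := Submodule.mem_span_finset.1 hxs
  have hsm : ∀ a ∈ s, a ∈ IsLocalRing.maximalIdeal A := fun a ha => hs ▸ Ideal.subset_span ha
  obtain ⟨a, ha, hca⟩ : ∃ a ∈ s, c a ∉ IsLocalRing.maximalIdeal A := by
    by_contra! hcon
    refine hx2 (hc ▸ Ideal.sum_mem _ fun a ha => ?_)
    rw [sq]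
    exact Ideal.mul_mem_mul (hcon a ha) (hsm a ha)
  refine ⟨a, ha, le_antisymm ?_ ?_⟩
  · rw [← hs, Ideal.span_le]
    intro b hb
    by_cases hba : b = a
    · subst hba
      rw [IsLocalRing.mem_maximalIdeal, mem_nonunits_iff, not_not] at hca
      refine (Ideal.unit_mul_mem_iff_mem _ hca).1 ?_
      have hsum : c b * b = x - ∑ i ∈ s.erase b, c i • i := by
        rw [← hc, ← Finset.add_sum_erase s _ ha, smul_eq_mul]; ring
      rw [hsum]
      refine Ideal.sub_mem _ (Ideal.subset_span (Set.mem_insert _ _)) (Ideal.sum_mem _ fun i hi => ?_)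
      exact Ideal.mul_mem_left _ _ (Ideal.subset_span (Set.mem_insert_of_mem _ hi))
    · exact Ideal.subset_span (Set.mem_insert_of_mem _ (by simp_all))
  · rw [Ideal.span_le]
    rintro b (rfl | hb)
    · exact hx
    · exact hsm b (Finset.mem_of_mem_erase hb)

theorem isDomain_and_regularChain (d : ℕ) : ∀ (A : Type) [CommRing A] [IsLocalRing A]
    [IsNoetherianRing A], (d : WithBot ℕ∞) ≤ ringKrullDim A → ∀ s : Finset A, s.card ≤ d →
    Ideal.span (s : Set A) = IsLocalRing.maximalIdeal A →
    IsDomain A ∧ RegularChain ⊥ (IsLocalRing.maximalIdeal A) d := by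
  classical
  induction d with
  | zero =>
    intro A _ _ _ _ s hcard hs
    obtain rfl : s = ∅ := Finset.card_eq_zero.1 (Nat.le_zero.1 hcard)
    have hbot : IsLocalRing.maximalIdeal A = ⊥ := by rw [← hs]; simp
    refine ⟨(IsLocalRing.isField_iff_maximalIdeal_eq.2 hbot).isDomain, hbot ▸ .nil _⟩
  | succ d ih =>
    intro A _ _ _ hd s hcard hs
    obtain ⟨x, hx, hx2, hmin⟩ := exists_mem_maximalIdeal_notMem
      (le_trans (by exact_mod_cast Nat.le_add_left 1 d) hd)
    obtain ⟨a, ha, hspan⟩ := exists_span_insert_erase hs hx hx2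
    set π := Ideal.Quotient.mk (Ideal.span {x}) with hπ
    have hsurj : Function.Surjective π := Ideal.Quotient.mk_surjective
    have hne : Ideal.span {x} ≠ ⊤ := fun h =>
      (IsLocalRing.mem_maximalIdeal x).1 hx (Ideal.span_singleton_eq_top.1 h)
    have : Nontrivial (A ⧸ Ideal.span {x}) := Ideal.Quotient.nontrivial_iff.2 hne
    have : IsLocalRing (A ⧸ Ideal.span {x}) := IsLocalRing.of_surjective' π hsurj
    have hloc : IsLocalHom π := hsurj.isLocalHom
    have hcomap : (IsLocalRing.maximalIdeal (A ⧸ Ideal.span {x})).comap π =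
      IsLocalRing.maximalIdeal A := IsLocalRing.maximalIdeal_comap π
    have hdim : (d : WithBot ℕ∞) ≤ ringKrullDim (A ⧸ Ideal.span {x}) := by
      have h1 := ringKrullDim_le_ringKrullDim_quotient_add_card (R := A) {x}
        (by simpa [IsLocalRing.ringJacobson_eq_maximalIdeal] using hx)
      rw [Finset.coe_singleton, Finset.card_singleton, Nat.cast_one] at h1
      exact ENat.WithBot.add_le_add_one_right_iff.1 (by exact_mod_cast hd.trans h1)
    obtain ⟨hdom, hchain⟩ := ih (A ⧸ Ideal.span {x}) hdim ((s.erase a).image π)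
      (Finset.card_image_le.trans (by rw [Finset.card_erase_of_mem ha]; omega)) (by
        rw [← Ideal.map_comap_of_surjective π hsurj (IsLocalRing.maximalIdeal _), hcomap, hspan,
          Ideal.map_span, Set.image_insert_eq, Finset.coe_image]
        have : π x = 0 := Ideal.Quotient.eq_zero_iff_mem.2 (Ideal.mem_span_singleton_self x)
        rw [this, Ideal.span_insert_zero])
    have : (Ideal.span {x}).IsPrime := (Ideal.Quotient.isDomain_iff_prime _).1 hdom
    have hA := isDomain_of_isPrime_span_singleton hx hmin
    refine ⟨hA, .cons x (fun y hy => ?_) ?_⟩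
    · rw [Ideal.mem_bot] at hy ⊢
      refine (mul_eq_zero.1 hy).resolve_left ?_
      rintro rfl
      exact hx2 (zero_mem _)
    · have := hchain.comap π hsurj
      rw [hcomap] at this
      convert this using 1
      rw [bot_sup_eq, ← RingHom.ker_eq_comap_bot, hπ, Ideal.mk_ker]

end RegularChain

section MatrixComplex

open Matrix

variable {A : Type*} [CommRing A] {b : ℕ → ℕ} {M : ∀ i, Matrix (Fin (b i)) (Fin (b (i + 1))) A}

/-- Exactness modulo `I`, at position `i + 1`, of the sequence of matrices `M`. -/
def ExactModAt (M : ∀ i, Matrix (Fin (b i)) (Fin (b (i + 1))) A) (I : Ideal A) (i : ℕ) : Prop :=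
  ∀ v : Fin (b (i + 1)) → A, (∀ a, (M i *ᵥ v) a ∈ I) →
    ∃ u, ∀ a, v a - (M (i + 1) *ᵥ u) a ∈ I

lemma mulVec_mem {m n : Type*} [Fintype n] (N : Matrix m n A) {I : Ideal A} {v : n → A}
    (hv : ∀ a, v a ∈ I) (a : m) : (N *ᵥ v) a ∈ I :=
  Ideal.sum_mem _ fun c _ => Ideal.mul_mem_left _ _ (hv c)

lemma mulVec_sub_mem {m n : Type*} [Fintype n] (N : Matrix m n A) {I : Ideal A} {v w : n → A}
    (hv : ∀ a, v a - w a ∈ I) (a : m) : (N *ᵥ v) a - (N *ᵥ w) a ∈ I := by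
  have := mulVec_mem N (v := v - w) hv a
  rwa [mulVec_sub] at this

lemma ExactModAt.succ (hM : ∀ i, M i * M (i + 1) = 0) {I : Ideal A} {i : ℕ} {x : A}
    (hx : ∀ y, x * y ∈ I → y ∈ I) (h : ExactModAt M I i) (h' : ExactModAt M I (i + 1)) :
    ExactModAt M (I ⊔ Ideal.span {x}) (i + 1) := by
  intro v hv
  choose w hw using fun a => mem_sup_span_singleton.1 (hv a)
  obtain ⟨u, hu⟩ := h w fun a => hx _ <| by
    have := mulVec_sub_mem (M i) (v := M (i + 1) *ᵥ v) (w := x • w) hw a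
    rw [mulVec_mulVec, hM, zero_mulVec, mulVec_smul] at this
    simpa using this
  obtain ⟨u', hu'⟩ := h' (v - x • u) fun a => by
    have := I.add_mem (hw a) (I.mul_mem_left x (hu a))
    rw [mulVec_sub, mulVec_smul]
    convert this using 1
    simp only [Pi.sub_apply, Pi.smul_apply, smul_eq_mul]
    ring
  refine ⟨u', fun a => mem_sup_span_singleton.2 ⟨u a, ?_⟩⟩
  convert hu' a using 1
  simp only [Pi.sub_apply, Pi.smul_apply, smul_eq_mul]
  ring

lemma ExactModAt.of_regularChain (hM : ∀ i, M i * M (i + 1) = 0) {I J : Ideal A} {n : ℕ}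
    (hIJ : RegularChain I J n) : ∀ {j : ℕ}, (∀ i, j ≤ i → ExactModAt M I i) →
    ∀ i, j + n ≤ i → ExactModAt M J i := by
  induction hIJ with
  | nil => exact fun h i hi => h i (by omega)
  | cons x hx _ ih =>
    intro j h i hi
    refine ih (j := j + 1) (fun i hi => ?_) i (by omega)
    obtain ⟨i, rfl⟩ : ∃ i', i = i' + 1 := ⟨i - 1, by omega⟩
    exact (h i (by omega)).succ hM hx (h (i + 1) (by omega))

/-- A minimal complex of free modules, exact in positions `> j`, over a local ring whose maximal
ideal is generated by a regular sequence of length `n`, vanishes in positions `> j + n`. -/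
lemma eq_zero_of_exactModAt [IsLocalRing A] (hM : ∀ i, M i * M (i + 1) = 0)
    (hmin : ∀ i a c, M i a c ∈ IsLocalRing.maximalIdeal A) {n : ℕ}
    (hA : RegularChain ⊥ (IsLocalRing.maximalIdeal A) n) {j : ℕ}
    (h : ∀ i, j ≤ i → ExactModAt M ⊥ i) {i : ℕ} (hi : j + n ≤ i) : b (i + 1) = 0 := by
  by_contra hb
  have hM' : ∀ i (v : Fin (b (i + 1)) → A) a, (M i *ᵥ v) a ∈ IsLocalRing.maximalIdeal A :=
    fun i v a => by
      rw [mulVec, dotProduct]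
      exact Ideal.sum_mem _ fun c _ => Ideal.mul_mem_right _ _ (hmin i a c)
  obtain ⟨u, hu⟩ := ExactModAt.of_regularChain hM hA h i hi 1 (hM' i 1)
  let a : Fin (b (i + 1)) := ⟨0, Nat.pos_of_ne_zero hb⟩
  have := Ideal.add_mem _ (hu a) (hM' (i + 1) u a)
  rw [sub_add_cancel] at this
  exact (IsLocalRing.mem_maximalIdeal _).1 this isUnit_one

/-- The cokernel of `M r`, reduced modulo `I`, has a nonzero class killed by `J`. -/
def HasSocleModAt (M : ∀ i, Matrix (Fin (b i)) (Fin (b (i + 1))) A) (J I : Ideal A) (r : ℕ) :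
    Prop :=
  ∃ v : Fin (b r) → A, (¬ ∃ u, ∀ a, v a - (M r *ᵥ u) a ∈ I) ∧
    ∀ y ∈ J, ∃ u, ∀ a, y * v a - (M r *ᵥ u) a ∈ I

lemma HasSocleModAt.succ (hM : ∀ i, M i * M (i + 1) = 0) {I J : Ideal A} {r : ℕ} {x : A}
    (hxJ : x ∈ J) (hx : ∀ y, x * y ∈ I → y ∈ I) (h : ExactModAt M I r)
    (hs : HasSocleModAt M J I r) : HasSocleModAt M J (I ⊔ Ideal.span {x}) (r + 1) := by
  obtain ⟨v, hv, hvJ⟩ := hs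
  obtain ⟨u, hu⟩ := hvJ x hxJ
  refine ⟨u, ?_, fun y hy => ?_⟩
  · rintro ⟨w, hw⟩
    choose u' hu' using fun a => mem_sup_span_singleton.1 (hw a)
    refine hv ⟨u', fun a => hx _ ?_⟩
    have := mulVec_sub_mem (M r) (v := u - M (r + 1) *ᵥ w) (w := x • u') hu' a
    rw [mulVec_sub, mulVec_mulVec, hM, zero_mulVec, mulVec_smul, sub_zero] at this
    convert I.add_mem (hu a) this using 1
    simp only [Pi.smul_apply, smul_eq_mul]
    ring
  · obtain ⟨uy, huy⟩ := hvJ y hy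
    obtain ⟨w, hw⟩ := h (y • u - x • uy) fun a => by
      have := I.sub_mem (I.mul_mem_left x (huy a)) (I.mul_mem_left y (hu a))
      rw [mulVec_sub, mulVec_smul, mulVec_smul]
      convert this using 1
      simp only [Pi.sub_apply, Pi.smul_apply, smul_eq_mul]
      ring
    refine ⟨w, fun a => mem_sup_span_singleton.2 ⟨uy a, ?_⟩⟩
    convert hw a using 1
    simp only [Pi.sub_apply, Pi.smul_apply, smul_eq_mul]
    ring

lemma RegularChain.le {I J : Ideal A} {n : ℕ} (h : RegularChain I J n) : I ≤ J := by
  induction h with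
  | nil => exact le_rfl
  | cons x hx _ ih => exact le_sup_left.trans ih

lemma HasSocleModAt.of_regularChain (hM : ∀ i, M i * M (i + 1) = 0) {I J : Ideal A} {n : ℕ}
    (hIJ : RegularChain I J n) : ∀ {r : ℕ}, (∀ i, r ≤ i → ExactModAt M I i) →
    HasSocleModAt M J I r → HasSocleModAt M J J (r + n) := by
  induction hIJ with
  | nil => exact fun _ hs => hs
  | @cons I J n x hx hc ih =>
    intro r h hs
    have hxJ : x ∈ J := hc.le (Ideal.mem_sup_right (Ideal.mem_span_singleton_self x))
    have := ih (r := r + 1) (fun i hi => by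
      obtain ⟨i, rfl⟩ : ∃ i', i = i' + 1 := ⟨i - 1, by omega⟩
      exact (h i (by omega)).succ hM hx (h (i + 1) (by omega))) (hs.succ hM hxJ hx (h r le_rfl))
    rwa [Nat.add_right_comm, Nat.add_assoc] at this

/-- A free resolution of a module with nonzero socle has length at least the length of a
regular sequence generating the ideal. -/
lemma ne_zero_of_hasSocleModAt (hM : ∀ i, M i * M (i + 1) = 0) {J : Ideal A} {n : ℕ}
    (hJ : RegularChain ⊥ J n) (h : ∀ i, ExactModAt M ⊥ i) (hs : HasSocleModAt M J ⊥ 0) :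
    b n ≠ 0 := by
  intro hb
  obtain ⟨v, hv, -⟩ := HasSocleModAt.of_regularChain hM hJ (fun i _ => h i) hs
  refine hv ⟨0, fun a => ?_⟩
  rw [Nat.zero_add, hb] at a
  exact a.elim0

end MatrixComplex

section GradedLinearMaps

variable {R₀ : Type} [CommRing R₀] {R : Type} [CommRing R] [Algebra R₀ R]
  {𝒜 : ℤ → Submodule R₀ R}

lemma map_apply_eq_sum {β β' : ℤ → ℕ} (φ : stdFree R β' →ₗ[R] stdFree R β) (x : stdFree R β')
    (t : Σ j : ℤ, Fin (β j)) :
    φ x t = x.sum fun p r => r * φ (Finsupp.single p 1) t := by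
  conv_lhs => rw [← Finsupp.sum_single x]
  rw [Finsupp.sum, map_sum, Finsupp.finsetSum_apply, Finsupp.sum]
  refine Finset.sum_congr rfl fun p _ => ?_
  rw [← Finsupp.smul_single_one, map_smul, Finsupp.smul_apply, smul_eq_mul]

/-- A homomorphism of free modules preserving the standard gradings. -/
def IsGradedMap (𝒜 : ℤ → Submodule R₀ R) {β β' : ℤ → ℕ}
    (φ : stdFree R β' →ₗ[R] stdFree R β) : Prop :=
  ∀ n x, x ∈ stdFreeGrading R₀ R 𝒜 β' n → φ x ∈ stdFreeGrading R₀ R 𝒜 β n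

lemma single_mem_stdFreeGrading {β : ℤ → ℕ} {n : ℤ} (p : Σ j : ℤ, Fin (β j)) {r : R}
    (hr : r ∈ 𝒜 (n - p.1)) : Finsupp.single p r ∈ stdFreeGrading R₀ R 𝒜 β n := by
  classical
  intro q
  rw [Finsupp.single_apply]
  split_ifs with h
  · exact h ▸ hr
  · exact zero_mem _

lemma IsGradedMap.entry_mem [SetLike.GradedMonoid 𝒜] {β β' : ℤ → ℕ}
    {φ : stdFree R β' →ₗ[R] stdFree R β} (hφ : IsGradedMap 𝒜 φ) (p : Σ j : ℤ, Fin (β' j))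
    (q : Σ j : ℤ, Fin (β j)) : φ (Finsupp.single p 1) q ∈ 𝒜 (p.1 - q.1) :=
  hφ p.1 _ (single_mem_stdFreeGrading p (by simpa using SetLike.GradedOne.one_mem)) q

/-- The homogeneous component of degree `n` of an element of a graded free module. -/
def stdFreeComp (𝒜 : ℤ → Submodule R₀ R) [GradedAlgebra 𝒜] {β : ℤ → ℕ} (n : ℤ)
    (x : stdFree R β) : stdFree R β :=
  Finsupp.onFinset x.support (fun p => (decompose 𝒜 (x p) (n - p.1) : R)) fun p hp => by
    rw [Finsupp.mem_support_iff]
    intro h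
    simp [h] at hp

lemma stdFreeComp_apply [GradedAlgebra 𝒜] {β : ℤ → ℕ} (n : ℤ) (x : stdFree R β)
    (p : Σ j : ℤ, Fin (β j)) : stdFreeComp 𝒜 n x p = decompose 𝒜 (x p) (n - p.1) := rfl

lemma stdFreeComp_mem [GradedAlgebra 𝒜] {β : ℤ → ℕ} (n : ℤ) (x : stdFree R β) :
    stdFreeComp 𝒜 n x ∈ stdFreeGrading R₀ R 𝒜 β n :=
  fun _ => SetLike.coe_mem _

lemma stdFreeComp_of_mem [GradedAlgebra 𝒜] {β : ℤ → ℕ} {n : ℤ} {x : stdFree R β}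
    (hx : x ∈ stdFreeGrading R₀ R 𝒜 β n) : stdFreeComp 𝒜 n x = x := by
  ext p
  rw [stdFreeComp_apply, decompose_of_mem_same _ (hx p)]

lemma IsGradedMap.map_comp [GradedAlgebra 𝒜] {β β' : ℤ → ℕ}
    {φ : stdFree R β' →ₗ[R] stdFree R β} (hφ : IsGradedMap 𝒜 φ) (n : ℤ) (x : stdFree R β') :
    φ (stdFreeComp 𝒜 n x) = stdFreeComp 𝒜 n (φ x) := by
  ext t
  rw [stdFreeComp_apply, map_apply_eq_sum, map_apply_eq_sum, Finsupp.sum, Finsupp.sum, decompose_sum,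
    DFinsupp.finsetSum_apply, AddSubmonoidClass.coe_finsetSum]
  rw [Finset.sum_subset (s₂ := x.support)]
  · refine Finset.sum_congr rfl fun p _ => ?_
    rw [stdFreeComp_apply, ← coe_decompose_mul_add_of_right_mem 𝒜 (hφ.entry_mem p t),
      sub_add_sub_cancel]
  · intro p hp
    rw [Finsupp.mem_support_iff, stdFreeComp_apply] at hp
    rw [Finsupp.mem_support_iff]
    intro h
    simp [h] at hp
  · intro p _ hp
    rw [Finsupp.notMem_support_iff.1 hp, zero_mul]

lemma IsGradedMap.exists_mem_of_mem_range [GradedAlgebra 𝒜] {β β' : ℤ → ℕ}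
    {φ : stdFree R β' →ₗ[R] stdFree R β} (hφ : IsGradedMap 𝒜 φ) {n : ℤ} {z : stdFree R β}
    (hz : z ∈ stdFreeGrading R₀ R 𝒜 β n) (hr : ∃ y, φ y = z) :
    ∃ y ∈ stdFreeGrading R₀ R 𝒜 β' n, φ y = z := by
  obtain ⟨y, rfl⟩ := hr
  exact ⟨_, stdFreeComp_mem n y, by rw [hφ.map_comp, stdFreeComp_of_mem hz]⟩

section Support

variable [SetLike.GradedMonoid 𝒜] (hneg : ∀ n : ℤ, n < 0 → 𝒜 n = ⊥) {β β' : ℤ → ℕ}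
  {φ : stdFree R β' →ₗ[R] stdFree R β} (hφ : IsGradedMap 𝒜 φ)
include hneg hφ

lemma IsGradedMap.entry_eq_zero {p : Σ j : ℤ, Fin (β' j)} {t : Σ j : ℤ, Fin (β j)}
    (h : p.1 < t.1) : φ (Finsupp.single p 1) t = 0 := by
  have := hφ.entry_mem p t
  rwa [hneg _ (by omega), Submodule.mem_bot] at this

lemma IsGradedMap.apply_eq_zero {q : ℤ} {x : stdFree R β'} (hx : ∀ p, q ≤ p.1 → x p = 0)
    {t : Σ j : ℤ, Fin (β j)} (ht : q ≤ t.1) : φ x t = 0 := by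
  rw [map_apply_eq_sum]
  refine Finset.sum_eq_zero fun p hp => ?_
  by_cases hpt : p.1 < t.1
  · simp only [hφ.entry_eq_zero hneg hpt, mul_zero]
  · exact absurd (hx p (by omega)) (Finsupp.mem_support_iff.1 hp)

lemma IsGradedMap.apply_eq_sum {q : ℤ} {x : stdFree R β'} (hx : ∀ p, q < p.1 → x p = 0)
    (a : Fin (β q)) :
    φ x ⟨q, a⟩ = ∑ c, x ⟨q, c⟩ * φ (Finsupp.single ⟨q, c⟩ 1) ⟨q, a⟩ := by
  classical
  rw [map_apply_eq_sum, Finsupp.sum]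
  let e : Fin (β' q) ↪ Σ j : ℤ, Fin (β' j) := Function.Embedding.sigmaMk (β := fun j => Fin (β' j)) q
  change _ = ∑ c, (fun p => x p * φ (Finsupp.single p 1) ⟨q, a⟩) (e c)
  rw [← Finset.sum_map Finset.univ e (fun p => x p * φ (Finsupp.single p 1) ⟨q, a⟩)]
  rw [Finset.sum_subset (Finset.subset_union_left (s₂ := Finset.univ.map e))]
  · refine (Finset.sum_subset Finset.subset_union_right fun p hp hpe => ?_).symm
    rcases lt_trichotomy p.1 q with h | h | h
    · simp only [hφ.entry_eq_zero hneg (t := ⟨q, a⟩) h, mul_zero]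
    · obtain ⟨j, c⟩ := p
      obtain rfl : j = q := h
      exact absurd (Finset.mem_map.2 ⟨c, Finset.mem_univ _, rfl⟩) hpe
    · simp only [hx p h, zero_mul]
  · intro p _ hp
    simp only [Finsupp.notMem_support_iff.1 hp, zero_mul]

end Support

/-- The element of a graded free module supported on the generators of degree `q`. -/
def stdFreeOfDegree {β : ℤ → ℕ} (q : ℤ) (g : Fin (β q) → R) : stdFree R β :=
  Finsupp.embDomain (Function.Embedding.sigmaMk (β := fun j => Fin (β j)) q)
    (Finsupp.equivFunOnFinite.symm g)

@[simp]
lemma stdFreeOfDegree_apply {β : ℤ → ℕ} (q : ℤ) (g : Fin (β q) → R) (a : Fin (β q)) :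
    stdFreeOfDegree (β := β) q g ⟨q, a⟩ = g a :=
  Finsupp.embDomain_apply_self (Function.Embedding.sigmaMk (β := fun j => Fin (β j)) q) _ a

lemma stdFreeOfDegree_apply_of_ne {β : ℤ → ℕ} {q : ℤ} (g : Fin (β q) → R)
    {p : Σ j : ℤ, Fin (β j)} (hp : p.1 ≠ q) : stdFreeOfDegree (β := β) q g p = 0 :=
  Finsupp.embDomain_of_notMem_range _ _ _ (by rintro ⟨a, rfl⟩; exact hp rfl)

lemma stdFreeOfDegree_mem {β : ℤ → ℕ} {q n : ℤ} {g : Fin (β q) → R}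
    (hg : ∀ a, g a ∈ 𝒜 (n - q)) : stdFreeOfDegree q g ∈ stdFreeGrading R₀ R 𝒜 β n := by
  rintro ⟨j, a⟩
  by_cases h : j = q
  · subst h
    simpa using hg a
  · rw [stdFreeOfDegree_apply_of_ne g h]
    exact zero_mem _

/-- The degree zero part, with respect to generators of degree `j`, of a map of free modules. -/
def strandMatrix (R₀ : Type) [CommRing R₀] [Algebra R₀ R] {β β' : ℤ → ℕ}
    (φ : stdFree R β' →ₗ[R] stdFree R β) (j : ℤ) : Matrix (Fin (β j)) (Fin (β' j)) R₀ :=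
  Matrix.of fun a c => Function.invFun (algebraMap R₀ R) (φ (Finsupp.single ⟨j, c⟩ 1) ⟨j, a⟩)

lemma IsGradedMap.algebraMap_strandMatrix [SetLike.GradedMonoid 𝒜] (h0 : 𝒜 0 = 1)
    {β β' : ℤ → ℕ} {φ : stdFree R β' →ₗ[R] stdFree R β} (hφ : IsGradedMap 𝒜 φ) (j : ℤ)
    (a : Fin (β j)) (c : Fin (β' j)) :
    algebraMap R₀ R (strandMatrix R₀ φ j a c) = φ (Finsupp.single ⟨j, c⟩ 1) ⟨j, a⟩ := by
  have := hφ.entry_mem ⟨j, c⟩ ⟨j, a⟩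
  rw [sub_self, h0, Submodule.mem_one] at this
  exact Function.invFun_eq this

end GradedLinearMaps

section GradedMax

open IsLocalRing

variable {R₀ : Type} [CommRing R₀] [IsLocalRing R₀] {R : Type} [CommRing R] [Algebra R₀ R]
  {𝒜 : ℤ → Submodule R₀ R} [GradedAlgebra 𝒜]

lemma decompose_zero_of_mem_gradedMax (hneg : ∀ n : ℤ, n < 0 → 𝒜 n = ⊥) (h0 : 𝒜 0 = 1)
    {r : R} (hr : r ∈ gradedMax R₀ R 𝒜) :
    ∃ y ∈ maximalIdeal R₀, (decompose 𝒜 r 0 : R) = algebraMap R₀ R y := by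
  rw [gradedMax, irrelevant, ← Ideal.span_union] at hr
  induction hr using Submodule.closure_induction with
  | zero => exact ⟨0, zero_mem _, by simp⟩
  | add r s _ _ hr hs =>
    obtain ⟨y, hy, hr⟩ := hr
    obtain ⟨z, hz, hs⟩ := hs
    exact ⟨y + z, add_mem hy hz, by simp [decompose_add, hr, hs]⟩
  | smul_mem a x hx =>
    rw [smul_eq_mul]
    rcases hx with hx | ⟨y, hy, rfl⟩
    · obtain ⟨⟨n, hn⟩, hx⟩ := Set.mem_iUnion.1 hx
      refine ⟨0, zero_mem _, ?_⟩
      have ha : (decompose 𝒜 a (-n) : R) = 0 :=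
        (Submodule.mem_bot R₀).1 ((hneg _ (by omega)).le (decompose 𝒜 a (-n)).2)
      rw [← neg_add_cancel n, coe_decompose_mul_add_of_right_mem 𝒜 hx, ha, zero_mul, map_zero]
    · obtain ⟨c, hc⟩ := Submodule.mem_one.1 (h0.le (decompose 𝒜 a 0).2)
      have hy0 : algebraMap R₀ R y ∈ 𝒜 0 := h0 ▸ Submodule.mem_one.2 ⟨y, rfl⟩
      refine ⟨c * y, Ideal.mul_mem_left _ _ hy, ?_⟩
      have := coe_decompose_mul_add_of_right_mem 𝒜 (i := 0) (a := a) hy0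
      rwa [add_zero, ← hc, ← map_mul] at this

lemma mem_maximalIdeal_of_algebraMap_mem_gradedMax (hneg : ∀ n : ℤ, n < 0 → 𝒜 n = ⊥)
    (h0 : 𝒜 0 = 1) (hinj : Function.Injective (algebraMap R₀ R)) {y : R₀}
    (hy : algebraMap R₀ R y ∈ gradedMax R₀ R 𝒜) : y ∈ maximalIdeal R₀ := by
  obtain ⟨z, hz, h⟩ := decompose_zero_of_mem_gradedMax hneg h0 hy
  rw [decompose_of_mem_same 𝒜 (h0 ▸ Submodule.mem_one.2 ⟨y, rfl⟩)] at h
  rwa [hinj h]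

lemma one_notMem_gradedMax (hneg : ∀ n : ℤ, n < 0 → 𝒜 n = ⊥) (h0 : 𝒜 0 = 1)
    (hinj : Function.Injective (algebraMap R₀ R)) : (1 : R) ∉ gradedMax R₀ R 𝒜 := by
  rw [← map_one (algebraMap R₀ R)]
  exact fun h => (mem_maximalIdeal _).1
    (mem_maximalIdeal_of_algebraMap_mem_gradedMax hneg h0 hinj h) isUnit_one

end GradedMax

lemma apply_mem_of_mem_smul_top {R : Type*} [CommRing R] {ι : Type*} {I : Ideal R} {x : ι →₀ R}
    (hx : x ∈ I • (⊤ : Submodule R (ι →₀ R))) (p : ι) : x p ∈ I := by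
  refine Submodule.smul_induction_on (p := fun x : ι →₀ R => x p ∈ I) hx ?_ ?_
  · exact fun r hr n _ => Ideal.mul_mem_right _ _ hr
  · exact fun x y => add_mem

section Lifting

open MvPolynomial

variable {R₀ : Type} [CommRing R₀] {R : Type} [CommRing R] [Algebra R₀ R]
  {𝒜 : ℤ → Submodule R₀ R} {σ : Type*} {f : MvPolynomial σ R₀ →ₐ[R₀] R}

lemma algebraMap_injective_of_isHomogeneous
    (hf : ∀ p : MvPolynomial σ R₀, p.IsHomogeneous 0 → f p = 0 → p = 0) :
    Function.Injective (algebraMap R₀ R) := by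
  rw [injective_iff_map_eq_zero]
  intro r hr
  have := hf (C r) (isHomogeneous_C σ r) (by rwa [← algebraMap_eq, f.commutes])
  simpa using this

lemma exists_isHomogeneous_map_eq [GradedAlgebra 𝒜]
    (hgr : ∀ (n : ℕ), ∀ p ∈ homogeneousSubmodule σ R₀ n, f p ∈ 𝒜 n)
    (hsurj : Function.Surjective f) {s : ℕ} {r : R} (hr : r ∈ 𝒜 s) :
    ∃ p : MvPolynomial σ R₀, p.IsHomogeneous s ∧ f p = r := by
  obtain ⟨p, rfl⟩ := hsurj r
  refine ⟨homogeneousComponent s p, homogeneousComponent_mem s p, ?_⟩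
  conv_rhs => rw [← decompose_of_mem_same 𝒜 hr, ← sum_homogeneousComponent p, map_sum,
    decompose_sum, DFinsupp.finsetSum_apply, AddSubmonoidClass.coe_finsetSum]
  rw [Finset.sum_eq_single s]
  · rw [decompose_of_mem_same 𝒜 (hgr s _ (homogeneousComponent_mem s p))]
  · intro n _ hn
    exact decompose_of_mem_ne 𝒜 (hgr n _ (homogeneousComponent_mem n p)) (by exact_mod_cast hn)
  · intro hs
    rw [homogeneousComponent_eq_zero _ _ (by simpa using hs), map_zero, decompose_zero]
    rfl

/-- Exactness of matrices over the base ring persists in those degrees where the graded ring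
is free over the base. -/
lemma exists_sum_mul_algebraMap_eq [GradedAlgebra 𝒜]
    (hgr : ∀ (n : ℕ), ∀ p ∈ homogeneousSubmodule σ R₀ n, f p ∈ 𝒜 n)
    (hsurj : Function.Surjective f) {s : ℕ}
    (hs : ∀ p : MvPolynomial σ R₀, p.IsHomogeneous s → f p = 0 → p = 0)
    {ι κ τ : Type*} [Fintype κ] [Fintype τ] {A : Matrix ι κ R₀} {B : Matrix κ τ R₀}
    (hAB : ∀ v, A.mulVec v = 0 → ∃ u, B.mulVec u = v) {g : κ → R} (hg : ∀ c, g c ∈ 𝒜 s)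
    (hA : ∀ a, ∑ c, g c * algebraMap R₀ R (A a c) = 0) :
    ∃ h : τ → R, (∀ c, h c ∈ 𝒜 s) ∧ ∀ a, ∑ c, h c * algebraMap R₀ R (B a c) = g a := by
  classical
  choose p hp hpg using fun c => exists_isHomogeneous_map_eq hgr hsurj (hg c)
  have hpA : ∀ a, ∑ c, p c * C (A a c) = 0 := fun a => by
    refine hs _ (IsHomogeneous.sum _ _ _ fun c _ => ?_) ?_
    · simpa using (hp c).mul (isHomogeneous_C σ (A a c))
    · simpa [hpg, ← MvPolynomial.algebraMap_eq] using hA a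
  choose u hu using fun μ => hAB (fun c => coeff μ (p c)) <| by
    ext a
    have := congrArg (coeff μ) (hpA a)
    simp_rw [coeff_sum, mul_comm _ (C _), coeff_C_mul] at this
    exact this
  have hC : ∀ y, algebraMap R₀ R y = f (C y) := fun y => (f.commutes y).symm
  let T := Finset.univ.biUnion fun c => (p c).support
  refine ⟨fun c => f (∑ μ ∈ T, monomial μ (u μ c)), fun c => hgr s _ ?_, fun a => ?_⟩
  · refine Submodule.sum_mem _ fun μ hμ => isHomogeneous_monomial _ ?_
    obtain ⟨c, -, hc⟩ := Finset.mem_biUnion.1 hμ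
    rw [Finsupp.degree_eq_weight_one]
    exact hp c (mem_support_iff.1 hc)
  · rw [← hpg a, ← support_sum_monomial_coeff (p a), Finset.sum_subset (s₂ := T)]
    · simp_rw [hC, ← map_mul, ← map_sum, Finset.sum_mul]
      congr 1
      rw [Finset.sum_comm]
      refine Finset.sum_congr rfl fun μ _ => ?_
      rw [← congrFun (hu μ) a, Matrix.mulVec, dotProduct, map_sum]
      refine Finset.sum_congr rfl fun c _ => ?_
      rw [mul_comm, C_mul_monomial]
    · exact Finset.subset_biUnion_of_mem (fun c => (p c).support) (Finset.mem_univ a)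
    · intro μ _ hμ
      rw [notMem_support_iff.1 hμ, monomial_zero]

end Lifting

lemma MinGradedFreeRes.single_notMem_range {R₀ : Type} [CommRing R₀] {R : Type} [CommRing R]
    [Algebra R₀ R] {𝒜 : ℤ → Submodule R₀ R} {M : Type} [AddCommGroup M] [Module R M] [Module R₀ M]
    {ℳ : ℤ → Submodule R₀ M} {I : Ideal R} (hI : (1 : R) ∉ I)
    (F : MinGradedFreeRes R₀ R 𝒜 M I ℳ) (i : ℕ) (p : Σ j : ℤ, Fin (F.β i j)) :
    Finsupp.single p 1 ∉ LinearMap.range (F.d i) := fun h =>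
  hI (by simpa using apply_mem_of_mem_smul_top (F.minimal i h) p)

section ResidueFieldResolution

open IsLocalRing

variable {R₀ : Type} [CommRing R₀] [IsLocalRing R₀] {R : Type} [CommRing R] [Algebra R₀ R]
  {𝒜 : ℤ → Submodule R₀ R} [GradedAlgebra 𝒜]

variable (hneg : ∀ n : ℤ, n < 0 → 𝒜 n = ⊥) (h0 : 𝒜 0 = 1)
  (hinj : Function.Injective (algebraMap R₀ R))
  (F : MinGradedFreeRes R₀ R 𝒜 (resField R₀ R 𝒜) (gradedMax R₀ R 𝒜) (resFieldGrading R₀ R 𝒜))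

include hneg h0 hinj

lemma MinGradedFreeRes.β_eq_zero_of_neg (i : ℕ) : ∀ j < 0, F.β i j = 0 := by
  have h1 := one_notMem_gradedMax hneg h0 hinj
  induction i with
  | zero =>
    intro j hj
    by_contra hb
    let p : Σ j : ℤ, Fin (F.β 0 j) := ⟨j, ⟨0, Nat.pos_of_ne_zero hb⟩⟩
    refine F.single_notMem_range h1 0 p ((F.exact_aug _).1 ?_)
    have := F.graded_aug j _ (single_mem_stdFreeGrading (r := 1) p
      (by simpa [p] using SetLike.GradedOne.one_mem))
    rwa [resFieldGrading, if_neg hj.ne, Submodule.mem_bot] at this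
  | succ i ih =>
    intro j hj
    by_contra hb
    let p : Σ j : ℤ, Fin (F.β (i + 1) j) := ⟨j, ⟨0, Nat.pos_of_ne_zero hb⟩⟩
    refine F.single_notMem_range h1 (i + 1) p ((F.exact i _).1 ?_)
    ext ⟨t, a⟩
    have ht : 0 ≤ t := by
      by_contra ht
      rw [ih t (by omega)] at a
      exact a.elim0
    exact IsGradedMap.entry_eq_zero hneg (F.graded_d i) (by simpa [p] using by omega)

omit [IsLocalRing R₀] hinj in
lemma IsGradedMap.apply_eq_sum_strandMatrix {β β' : ℤ → ℕ} {φ : stdFree R β' →ₗ[R] stdFree R β}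
    (hφ : IsGradedMap 𝒜 φ) {q : ℤ} {x : stdFree R β'} (hx : ∀ p, q < p.1 → x p = 0)
    (a : Fin (β q)) :
    φ x ⟨q, a⟩ = ∑ c, x ⟨q, c⟩ * algebraMap R₀ R (strandMatrix R₀ φ q a c) := by
  simp_rw [hφ.algebraMap_strandMatrix h0]
  exact hφ.apply_eq_sum hneg hx a

omit [IsLocalRing R₀] hinj in
lemma IsGradedMap.algebraMap_strandMatrix_mulVec {β β' : ℤ → ℕ}
    {φ : stdFree R β' →ₗ[R] stdFree R β} (hφ : IsGradedMap 𝒜 φ) {q : ℤ} (v : Fin (β' q) → R₀)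
    (a : Fin (β q)) :
    algebraMap R₀ R ((strandMatrix R₀ φ q).mulVec v a) =
      φ (stdFreeOfDegree q fun c => algebraMap R₀ R (v c)) ⟨q, a⟩ := by
  rw [hφ.apply_eq_sum_strandMatrix hneg h0
    fun p hp => stdFreeOfDegree_apply_of_ne _ hp.ne']
  simp [Matrix.mulVec, dotProduct, mul_comm]

lemma MinGradedFreeRes.strandMatrix_mul_strandMatrix (j : ℤ) (i : ℕ) :
    strandMatrix R₀ (F.d i) j * strandMatrix R₀ (F.d (i + 1)) j = 0 := by
  ext a c
  refine hinj ?_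
  have hi : IsGradedMap 𝒜 (F.d i) := F.graded_d i
  have hi' : IsGradedMap 𝒜 (F.d (i + 1)) := F.graded_d (i + 1)
  have := hi.apply_eq_sum_strandMatrix hneg h0 (q := j)
    (x := F.d (i + 1) (Finsupp.single ⟨j, c⟩ 1))
    (fun p hp => hi'.entry_eq_zero hneg hp) a
  rw [(F.exact i).apply_apply_eq_zero] at this
  simp_rw [← hi'.algebraMap_strandMatrix h0] at this
  simpa [Matrix.mul_apply, mul_comm] using this.symm

lemma MinGradedFreeRes.strandMatrix_mem (j : ℤ) (i : ℕ) (a : Fin (F.β i j))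
    (c : Fin (F.β (i + 1) j)) : strandMatrix R₀ (F.d i) j a c ∈ maximalIdeal R₀ := by
  refine mem_maximalIdeal_of_algebraMap_mem_gradedMax hneg h0 hinj ?_
  rw [IsGradedMap.algebraMap_strandMatrix h0 (F.graded_d i)]
  exact apply_mem_of_mem_smul_top (F.minimal i ⟨_, rfl⟩) _

lemma MinGradedFreeRes.hasSocleModAt_strandMatrix :
    HasSocleModAt (fun i => strandMatrix R₀ (F.d i) 0) (maximalIdeal R₀) ⊥ 0 := by
  classical
  obtain ⟨a, ha⟩ : ∃ a : Fin (F.β 0 0), F.aug (Finsupp.single ⟨0, a⟩ 1) ≠ 0 := by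
    by_contra! h
    have haug : F.aug = 0 := Finsupp.lhom_ext' fun ⟨j, a⟩ => LinearMap.ext_ring <| by
      by_cases hj : j = 0
      · subst hj
        exact h a
      · have := F.graded_aug j _ (single_mem_stdFreeGrading (r := 1) ⟨j, a⟩
          (by simpa using SetLike.GradedOne.one_mem))
        rwa [resFieldGrading, if_neg hj, Submodule.mem_bot] at this
    obtain ⟨x, hx⟩ := F.aug_surj (Ideal.Quotient.mk _ 1)
    rw [haug, LinearMap.zero_apply, eq_comm, Ideal.Quotient.eq_zero_iff_mem] at hx
    exact one_notMem_gradedMax hneg h0 hinj hx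
  have hd : IsGradedMap 𝒜 (F.d 0) := F.graded_d 0
  refine ⟨Pi.single a 1, ?_, fun y hy => ?_⟩
  · rintro ⟨u, hu⟩
    refine one_notMem_gradedMax hneg h0 hinj ?_
    have := (Submodule.mem_bot R₀).1 (hu a)
    rw [Pi.single_eq_same, sub_eq_zero] at this
    rw [← map_one (algebraMap R₀ R), this, hd.algebraMap_strandMatrix_mulVec hneg h0]
    exact apply_mem_of_mem_smul_top (F.minimal 0 ⟨_, rfl⟩) _
  · have hy' : algebraMap R₀ R y ∈ gradedMax R₀ R 𝒜 :=
      Ideal.mem_sup_right (Ideal.subset_span ⟨y, hy, rfl⟩)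
    have hker : F.aug (Finsupp.single ⟨0, a⟩ (algebraMap R₀ R y)) = 0 := by
      rw [← Finsupp.smul_single_one, map_smul]
      obtain ⟨r, hr⟩ := Ideal.Quotient.mk_surjective (F.aug (Finsupp.single ⟨0, a⟩ 1))
      rw [← hr, ← Ideal.Quotient.mk_eq_mk, ← Submodule.Quotient.mk_smul,
        Ideal.Quotient.mk_eq_mk, Ideal.Quotient.eq_zero_iff_mem]
      exact Ideal.mul_mem_right _ _ hy'
    obtain ⟨x, hx, hxy⟩ := hd.exists_mem_of_mem_range (n := 0)
      (single_mem_stdFreeGrading _ (by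
        rw [sub_self, h0]
        exact Submodule.mem_one.2 ⟨y, rfl⟩)) ((F.exact_aug _).1 hker)
    have hx0 : ∀ p : Σ j : ℤ, Fin (F.β 1 j), 0 < p.1 → x p = 0 := fun p hp => by
      have := hx p
      rwa [hneg _ (by omega), Submodule.mem_bot] at this
    choose u hu using fun c => Submodule.mem_one.1 (h0.le (by simpa using hx ⟨0, c⟩))
    refine ⟨u, fun b => (Submodule.mem_bot R₀).2 (hinj ?_)⟩
    have := congrArg (fun x => x ⟨0, b⟩) hxy
    rw [hd.apply_eq_sum_strandMatrix hneg h0 hx0] at this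
    simp_rw [← hu] at this
    rw [map_sub, map_zero, sub_eq_zero, Matrix.mulVec, dotProduct, map_sum]
    simp_rw [map_mul, mul_comm (algebraMap R₀ R (strandMatrix _ _ _ _ _))]
    rw [this]
    by_cases hb : b = a
    · subst hb
      simp
    · rw [Pi.single_eq_of_ne hb, Finsupp.single_eq_of_ne (by simpa using hb), map_zero, mul_zero]

section Strands

variable {d : ℕ} (hchain : RegularChain ⊥ (maximalIdeal R₀) d)
include hchain

lemma MinGradedFreeRes.β_succ_eq_zero {n : ℕ}
    (h : ∀ i, n ≤ i → ExactModAt (fun i => strandMatrix R₀ (F.d i) n) ⊥ i) {i : ℕ}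
    (hi : n + d ≤ i) : F.β (i + 1) n = 0 :=
  eq_zero_of_exactModAt (b := fun i => F.β i n) (F.strandMatrix_mul_strandMatrix hneg h0 hinj n)
    (fun i a c => F.strandMatrix_mem hneg h0 hinj n i a c) hchain h hi

open MvPolynomial

variable {σ : Type*} {f : MvPolynomial σ R₀ →ₐ[R₀] R}
  (hgr : ∀ (n : ℕ), ∀ p ∈ homogeneousSubmodule σ R₀ n, f p ∈ 𝒜 n)
  (hsurj : Function.Surjective f)
  (hI : ∀ (n : ℕ), ∀ p ∈ homogeneousSubmodule σ R₀ n, f p = 0 → p ≠ 0 → d + 1 ≤ n)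
include hgr hsurj hI

lemma MinGradedFreeRes.exists_map_eq_of_lt {n : ℕ}
    (hT : ∀ q < n, ∀ i, q ≤ i → ExactModAt (fun i => strandMatrix R₀ (F.d i) q) ⊥ i)
    {i : ℕ} (hi : n ≤ i) {q : ℕ} (hq : q ≤ n) : ∀ {z : stdFree R (F.β i)},
    z ∈ stdFreeGrading R₀ R 𝒜 (F.β i) n → (∀ p, (q : ℤ) ≤ p.1 → z p = 0) →
    (∃ y, F.d i y = z) →
    ∃ w ∈ stdFreeGrading R₀ R 𝒜 (F.β (i + 1)) n, (∀ p, (q : ℤ) ≤ p.1 → w p = 0) ∧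
      F.d i w = z := by
  induction q with
  | zero =>
    intro z _ hz _
    refine ⟨0, zero_mem _, fun _ _ => rfl, ?_⟩
    rw [map_zero]
    ext ⟨t, a⟩
    refine (hz _ ?_).symm
    by_contra ht
    rw [F.β_eq_zero_of_neg hneg h0 hinj i t (by simpa using ht)] at a
    exact a.elim0
  | succ q ih =>
    intro z hzn hz hzr
    obtain ⟨i, rfl⟩ : ∃ i', i = i' + 1 := ⟨i - 1, by omega⟩
    have hd : IsGradedMap 𝒜 (F.d i) := F.graded_d i
    have hd' : IsGradedMap 𝒜 (F.d (i + 1)) := F.graded_d (i + 1)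
    have hzq : ∀ p : Σ j : ℤ, Fin (F.β (i + 1) j), (q : ℤ) < p.1 → z p = 0 :=
      fun p hp => hz p (by push_cast; omega)
    obtain ⟨g, hg, hgz⟩ : ∃ g : Fin (F.β (i + 2) q) → R, (∀ c, g c ∈ 𝒜 (n - q : ℤ)) ∧
        ∀ a, ∑ c, g c * algebraMap R₀ R (strandMatrix R₀ (F.d (i + 1)) q a c) = z ⟨q, a⟩ := by
      by_cases hqd : q + d ≤ i
      · have hb := F.β_succ_eq_zero hneg h0 hinj hchain (hT q (by omega)) hqd
        refine ⟨0, fun _ => zero_mem _, fun a => ?_⟩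
        rw [hb] at a
        exact a.elim0
      · have hs : ((n - q : ℕ) : ℤ) = n - q := by omega
        rw [← hs]
        refine exists_sum_mul_algebraMap_eq hgr hsurj (s := n - q) (fun p hp hfp => ?_)
          (A := strandMatrix R₀ (F.d i) q) (fun v hv => ?_) (fun c => ?_) fun a => ?_
        · by_contra hp0
          have := hI _ p hp hfp hp0
          omega
        · obtain ⟨u, hu⟩ := hT q (by omega) i (by omega) v fun a => congrFun hv a
          exact ⟨u, funext fun a => (sub_eq_zero.1 (hu a)).symm⟩
        · rw [hs]
          exact hzn ⟨q, c⟩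
        · rw [← hd.apply_eq_sum_strandMatrix hneg h0 hzq]
          obtain ⟨y, rfl⟩ := hzr
          rw [(F.exact i).apply_apply_eq_zero, Finsupp.zero_apply]
    have hw := stdFreeOfDegree_mem hg
    have hwq : ∀ p : Σ j : ℤ, Fin (F.β (i + 2) j), (q : ℤ) < p.1 →
        stdFreeOfDegree (q : ℤ) g p = 0 := fun p hp => stdFreeOfDegree_apply_of_ne g hp.ne'
    obtain ⟨w, hwn, hw0, hwz⟩ := ih (by omega)
      (z := z - F.d (i + 1) (stdFreeOfDegree (q : ℤ) g)) (sub_mem hzn (hd' _ _ hw))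
      (fun p hp => by
        rw [Finsupp.sub_apply]
        rcases hp.eq_or_lt with hp | hp
        · obtain ⟨j, a⟩ := p
          obtain rfl : (q : ℤ) = j := hp
          rw [hd'.apply_eq_sum_strandMatrix hneg h0 hwq]
          simp [hgz]
        · rw [hzq p hp, hd'.apply_eq_zero hneg (q := q + 1)
            (fun p hp => hwq p (by omega)) (by omega), sub_zero])
      (by
        obtain ⟨y, rfl⟩ := hzr
        exact ⟨y - stdFreeOfDegree (q : ℤ) g, map_sub _ _ _⟩)
    refine ⟨stdFreeOfDegree (q : ℤ) g + w, add_mem hw hwn, fun p hp => ?_, ?_⟩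
    · push_cast at hp
      rw [Finsupp.add_apply, hwq p (by omega), hw0 p (by omega), add_zero]
    · rw [map_add, hwz, add_sub_cancel]

lemma MinGradedFreeRes.exactModAt_strandMatrix (n : ℕ) : ∀ i, n ≤ i →
    ExactModAt (fun i => strandMatrix R₀ (F.d i) n) ⊥ i := by
  induction n using Nat.strong_induction_on with
  | _ n hT =>
  intro i hi v hv
  have hd : IsGradedMap 𝒜 (F.d i) := F.graded_d i
  have hd' : IsGradedMap 𝒜 (F.d (i + 1)) := F.graded_d (i + 1)
  have hx : stdFreeOfDegree (n : ℤ) (fun c => algebraMap R₀ R (v c)) ∈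
      stdFreeGrading R₀ R 𝒜 (F.β (i + 1)) n :=
    stdFreeOfDegree_mem fun c => by
      rw [sub_self, h0]
      exact Submodule.mem_one.2 ⟨_, rfl⟩
  have hx0 : ∀ p : Σ j : ℤ, Fin (F.β (i + 1) j), (n : ℤ) < p.1 →
      stdFreeOfDegree (n : ℤ) (fun c => algebraMap R₀ R (v c)) p = 0 :=
    fun p hp => stdFreeOfDegree_apply_of_ne _ hp.ne'
  obtain ⟨w, hw, hw0, hwx⟩ := F.exists_map_eq_of_lt hneg h0 hinj hchain hgr hsurj hI hT hi le_rfl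
    (hd _ _ hx) (fun p hp => by
      rcases hp.eq_or_lt with hp | hp
      · obtain ⟨j, a⟩ := p
        obtain rfl : (n : ℤ) = j := hp
        rw [← hd.algebraMap_strandMatrix_mulVec hneg h0, (Submodule.mem_bot R₀).1 (hv a), map_zero]
      · exact hd.apply_eq_zero hneg (q := n + 1) (fun p hp => hx0 p (by omega)) (by omega))
    ⟨_, rfl⟩
  obtain ⟨u, hu, hux⟩ := hd'.exists_mem_of_mem_range (sub_mem hx hw)
    ((F.exact i _).1 (by rw [map_sub, hwx, sub_self]))
  have hu0 : ∀ p : Σ j : ℤ, Fin (F.β (i + 2) j), (n : ℤ) < p.1 → u p = 0 := fun p hp => by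
    have := hu p
    rwa [hneg _ (by omega), Submodule.mem_bot] at this
  choose u' hu' using fun c => Submodule.mem_one.1 (h0.le (by simpa using hu ⟨n, c⟩))
  refine ⟨u', fun a => (Submodule.mem_bot R₀).2 (hinj ?_)⟩
  have := congrArg (fun x => x ⟨(n : ℤ), a⟩) hux
  simp only [Finsupp.sub_apply, stdFreeOfDegree_apply, hw0 ⟨n, a⟩ le_rfl, sub_zero] at this
  rw [hd'.apply_eq_sum_strandMatrix hneg h0 hu0] at this
  rw [map_sub, ← this, map_zero, sub_eq_zero]
  simp [Matrix.mulVec, dotProduct, mul_comm, hu']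

lemma MinGradedFreeRes.isGreatest_regSet : IsGreatest (regSet R₀ R 𝒜 _ F) (d : ℤ) := by
  have hT := F.exactModAt_strandMatrix hneg h0 hinj hchain hgr hsurj hI
  constructor
  · refine ⟨d, 0, ?_, by simp⟩
    exact ne_zero_of_hasSocleModAt (b := fun i => F.β i 0)
      (F.strandMatrix_mul_strandMatrix hneg h0 hinj 0) hchain (fun i => hT 0 i i.zero_le)
      (F.hasSocleModAt_strandMatrix hneg h0 hinj)
  · rintro _ ⟨i, j, hij, rfl⟩
    by_contra! hlt
    obtain ⟨n, rfl⟩ : ∃ n : ℕ, j = n :=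
      Int.eq_ofNat_of_zero_le (not_lt.1 fun hj => hij (F.β_eq_zero_of_neg hneg h0 hinj i j hj))
    obtain ⟨i, rfl⟩ : ∃ i', i = i' + 1 := ⟨i - 1, by omega⟩
    exact hij (F.β_succ_eq_zero hneg h0 hinj hchain (hT n) (by push_cast at hlt; omega))

end Strands

end ResidueFieldResolution

section PolynomialGrading

open MvPolynomial

lemma mvGrading_eq_weightedHomogeneousSubmodule (R₀ : Type) [CommRing R₀] (m : ℕ) :
    mvGrading R₀ m = weightedHomogeneousSubmodule R₀ (fun _ : Fin m => (1 : ℤ)) := by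
  have hw : ∀ μ : Fin m →₀ ℕ, Finsupp.weight (fun _ => (1 : ℤ)) μ = (Finsupp.weight 1 μ : ℕ) := by
    intro μ
    simp [Finsupp.weight_apply, Finsupp.sum]
  funext z
  ext p
  rw [mvGrading, mem_weightedHomogeneousSubmodule, IsWeightedHomogeneous]
  simp_rw [hw]
  split_ifs with hz
  · rw [mem_homogeneousSubmodule, IsHomogeneous, IsWeightedHomogeneous]
    refine forall₂_congr fun μ _ => ?_
    omega
  · rw [Submodule.mem_bot]
    refine ⟨fun h μ hμ => absurd (by simp [h]) hμ, fun h => ?_⟩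
    ext μ
    by_contra hμ
    have := h hμ
    omega

/-- The standard grading of a polynomial ring. -/
instance mvGrading.gradedAlgebra (R₀ : Type) [CommRing R₀] (m : ℕ) : GradedAlgebra (mvGrading R₀ m) :=
  (mvGrading_eq_weightedHomogeneousSubmodule R₀ m).symm ▸
    weightedGradedAlgebra R₀ (fun _ : Fin m => (1 : ℤ))

lemma mvGrading_zero (R₀ : Type) [CommRing R₀] (m : ℕ) : mvGrading R₀ m 0 = 1 := by
  rw [mvGrading, if_pos le_rfl]
  exact homogeneousSubmodule_zero _

end PolynomialGrading

/-- If `R` agrees with a polynomial ring over a regular local ring of dimension `d` in degrees at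
most `d`, then `d` is the regularity of the residue field over `R`. -/
lemma IsRegularLocal.isGreatest_regSet {R₀ : Type} [CommRing R₀] [IsLocalRing R₀] {d : ℕ}
    (hreg : IsRegularLocal R₀ d) {R : Type} [CommRing R] [Algebra R₀ R] {𝒜 : ℤ → Submodule R₀ R}
    [GradedAlgebra 𝒜] (hneg : ∀ n : ℤ, n < 0 → 𝒜 n = ⊥) (h0 : 𝒜 0 = 1) {σ : Type*}
    {f : MvPolynomial σ R₀ →ₐ[R₀] R}
    (hgr : ∀ (n : ℕ), ∀ p ∈ MvPolynomial.homogeneousSubmodule σ R₀ n, f p ∈ 𝒜 n)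
    (hsurj : Function.Surjective f)
    (hI : ∀ (n : ℕ), ∀ p ∈ MvPolynomial.homogeneousSubmodule σ R₀ n,
      f p = 0 → p ≠ 0 → d + 1 ≤ n)
    (F : MinGradedFreeRes R₀ R 𝒜 (resField R₀ R 𝒜) (gradedMax R₀ R 𝒜)
      (resFieldGrading R₀ R 𝒜)) : IsGreatest (regSet R₀ R 𝒜 _ F) (d : ℤ) := by
  obtain ⟨hnoeth, hdim, s, hs, hspan⟩ := hreg
  refine F.isGreatest_regSet hneg h0 (algebraMap_injective_of_isHomogeneous (f := f) fun p hp hfp => ?_)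
    (isDomain_and_regularChain d R₀ hdim.ge s hs.le hspan).2 hgr hsurj hI
  by_contra hp0
  have := hI 0 p hp hfp hp0
  omega

/-- If `S` is a polynomial ring over a regular local ring `R₀` of dimension `d` and
`f : S → R` is surjective graded with `indeg (ker f) ≥ d + 1`, then
`reg_R(k,k) = reg_S(k,k) = d`. -/
theorem stmt6 (R₀ : Type) [CommRing R₀] [IsLocalRing R₀] (d : ℕ)
    (hreg : IsRegularLocal R₀ d) (m : ℕ)
    (R : Type) [CommRing R] [Algebra R₀ R] [IsNoetherianRing R]
    (𝒜 : ℤ → Submodule R₀ R) [GradedAlgebra 𝒜] (hstdR : IsStandardGraded R₀ R 𝒜)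
    (f : MvPolynomial (Fin m) R₀ →ₐ[R₀] R)
    (hgr : ∀ (n : ℕ), ∀ p ∈ MvPolynomial.homogeneousSubmodule (Fin m) R₀ n, f p ∈ 𝒜 n)
    (hsurj : Function.Surjective f)
    -- `indeg (ker f) ≥ d + 1`
    (hI : ∀ (n : ℕ), ∀ p ∈ MvPolynomial.homogeneousSubmodule (Fin m) R₀ n,
      f p = 0 → p ≠ 0 → d + 1 ≤ n)
    (FR : MinGradedFreeRes R₀ R 𝒜 (resField R₀ R 𝒜) (gradedMax R₀ R 𝒜)
      (resFieldGrading R₀ R 𝒜))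
    (FS : MinGradedFreeRes R₀ (MvPolynomial (Fin m) R₀) (mvGrading R₀ m)
      (resField R₀ (MvPolynomial (Fin m) R₀) (mvGrading R₀ m))
      (gradedMax R₀ (MvPolynomial (Fin m) R₀) (mvGrading R₀ m))
      (resFieldGrading R₀ (MvPolynomial (Fin m) R₀) (mvGrading R₀ m))) :
    IsGreatest (regSet R₀ R 𝒜 _ FR) (d : ℤ) ∧
      IsGreatest (regSet R₀ (MvPolynomial (Fin m) R₀) (mvGrading R₀ m) _ FS) (d : ℤ) := by
  refine ⟨hreg.isGreatest_regSet hstdR.1 hstdR.2.1 hgr hsurj hI FR, ?_⟩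
  refine hreg.isGreatest_regSet (𝒜 := mvGrading R₀ m) (fun n hn => if_neg (not_le.2 hn))
    (mvGrading_zero R₀ m)
    (f := AlgHom.id R₀ _) (fun n p hp => ?_) Function.surjective_id (fun n p _ hp hp0 => ?_) FS
  · rw [mvGrading, if_pos (Int.natCast_nonneg n)]
    exact hp
  · exact absurd hp hp0
end
end
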